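/- Let P and Q be probability distributions on finite sets, neither of which is a uniform distribution, with H(P)/V(P) > H(Q)/V(Q). For b ∈ ℝ let α(b) be the unique real solution of N_P(x)/N_{P,Q,b}(x) = G_P(x)/G_{P,Q,b}(x) and set F_1(b) := √(G_P(α(b))·G_{P,Q,b}(α(b))) + I_{P,Q,b}(∞) − I_{P,Q,b}(α(b)). Then for 0 < ν < 1 and any b ∈ ℝ with F_1(b) = ν, one has lim_{n→∞} (L^D_n(P,Q|ν) − (H(P)/H(Q))·n)/√n = b; in particular R^D_2(P,Q|ν) = b = F_1^{−1}(ν). -/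

import Mathlib

open MeasureTheory Filter

namespace RNG

variable {α β : Type*}

/-- `P` is a probability distribution on the finite set `α`. -/
def IsProb [Fintype α] (P : α → ℝ) : Prop :=
  (∀ x, 0 ≤ P x) ∧ ∑ x, P x = 1

open Classical in
/-- Pushforward distribution `W(P)(y) = ∑_{x : W x = y} P x`. -/
noncomputable def push [Fintype α] (W : α → β) (P : α → ℝ) : β → ℝ :=
  fun y => ∑ x, if W x = y then P x else 0

/-- Fidelity (Bhattacharyya coefficient) between distributions on the same finite set. -/
noncomputable def fid [Fintype β] (R S : β → ℝ) : ℝ :=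
  ∑ y, Real.sqrt (R y * S y)

/-- Sum of the `l` largest values of `P`, i.e. the `l`-th partial sum of the
decreasing rearrangement of `P` (padded with zeros). -/
noncomputable def topSum [Fintype α] (P : α → ℝ) (l : ℕ) : ℝ :=
  sSup {s : ℝ | ∃ A : Finset α, A.card ≤ l ∧ s = ∑ x ∈ A, P x}

/-- Majorization `P ≺ P'` (the distributions may live on different finite sets). -/
def Maj [Fintype α] [Fintype β] (P : α → ℝ) (P' : β → ℝ) : Prop :=
  ∀ l : ℕ, topSum P l ≤ topSum P' l

/-- Maximal fidelity under deterministic transformations,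
`F^D(P → Q) = max {F(W(P), Q) | W : α → β}`. -/
noncomputable def FD [Fintype α] [Fintype β] (P : α → ℝ) (Q : β → ℝ) : ℝ :=
  sSup {r : ℝ | ∃ W : α → β, r = fid (push W P) Q}

/-- Maximal fidelity under the majorization condition,
`F^M(P → Q) = max {F(P', Q) | P ≺ P', P'` a distribution on the target set`}`. -/
noncomputable def FM [Fintype α] [Fintype β] (P : α → ℝ) (Q : β → ℝ) : ℝ :=
  sSup {r : ℝ | ∃ P' : β → ℝ, IsProb P' ∧ Maj P P' ∧ r = fid P' Q}

/-- Shannon entropy (natural logarithm). -/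
noncomputable def H [Fintype α] (P : α → ℝ) : ℝ := ∑ x, -(P x * Real.log (P x))

/-- Varentropy `V(P)` (natural logarithm). -/
noncomputable def V [Fintype α] (P : α → ℝ) : ℝ :=
  ∑ x, P x * (-Real.log (P x) - H P) ^ 2

/-- Shannon entropy, base-2 logarithm. -/
noncomputable def H2 [Fintype α] (P : α → ℝ) : ℝ := ∑ x, -(P x * Real.logb 2 (P x))

/-- Varentropy, base-2 logarithm. -/
noncomputable def V2 [Fintype α] (P : α → ℝ) : ℝ :=
  ∑ x, P x * (-Real.logb 2 (P x) - H2 P) ^ 2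

/-- The `n`-fold i.i.d. product distribution `P^n`. -/
noncomputable def iid [Fintype α] (P : α → ℝ) (n : ℕ) : (Fin n → α) → ℝ :=
  fun f => ∏ i, P (f i)

/-- The uniform distribution on a two-element set. -/
noncomputable def U2 : Fin 2 → ℝ := fun _ => 1 / 2

/-- Density of the normal distribution `N(m, v)`. -/
noncomputable def normalPDF (m v t : ℝ) : ℝ :=
  (Real.sqrt (2 * Real.pi * v))⁻¹ * Real.exp (-(t - m) ^ 2 / (2 * v))

/-- Standard normal cumulative distribution function `G`. -/
noncomputable def stdG (x : ℝ) : ℝ := ∫ t in Set.Iic x, normalPDF 0 1 t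

/-- Density `N_P` of `N(0, V(P))`. -/
noncomputable def NP [Fintype α] (P : α → ℝ) (x : ℝ) : ℝ := normalPDF 0 (V P) x

/-- Density `N_{P,Q,b}` of `N(H(Q)b, (H(P)/H(Q))·V(Q))`. -/
noncomputable def NPQ [Fintype α] [Fintype β] (P : α → ℝ) (Q : β → ℝ) (b x : ℝ) : ℝ :=
  normalPDF (H Q * b) (H P / H Q * V Q) x

/-- Cdf `G_P(x) = G(x/√V(P))`. -/
noncomputable def GP [Fintype α] (P : α → ℝ) (x : ℝ) : ℝ := stdG (x / Real.sqrt (V P))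

/-- Cdf `G_{P,Q,b}(x) = G(√(H(Q)/(H(P)V(Q)))·(x − H(Q)b))`. -/
noncomputable def GPQ [Fintype α] [Fintype β] (P : α → ℝ) (Q : β → ℝ) (b x : ℝ) : ℝ :=
  stdG (Real.sqrt (H Q / (H P * V Q)) * (x - H Q * b))

/-- `I_{P,Q,b}(x) = ∫_{−∞}^x √(N_P(t) N_{P,Q,b}(t)) dt`. -/
noncomputable def IPQ [Fintype α] [Fintype β] (P : α → ℝ) (Q : β → ℝ) (b x : ℝ) : ℝ :=
  ∫ t in Set.Iic x, Real.sqrt (NP P t * NPQ P Q b t)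

/-- `I_{P,Q,b}(∞) = ∫_ℝ √(N_P(t) N_{P,Q,b}(t)) dt`. -/
noncomputable def IPQinf [Fintype α] [Fintype β] (P : α → ℝ) (Q : β → ℝ) (b : ℝ) : ℝ :=
  ∫ t : ℝ, Real.sqrt (NP P t * NPQ P Q b t)

/-- `L^D_n(P,Q|ν)`: the maximal `L` with `F^D(P^n → Q^L) ≥ ν`. -/
noncomputable def LD [Fintype α] [Fintype β] (P : α → ℝ) (Q : β → ℝ) (ν : ℝ) (n : ℕ) : ℕ :=
  sSup {L : ℕ | ν ≤ FD (iid P n) (iid Q L)}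

/-- The optimal second order rate `R^D_2(P,Q|ν)`. -/
noncomputable def RD2 [Fintype α] [Fintype β] (P : α → ℝ) (Q : β → ℝ) (ν : ℝ) : ℝ :=
  sSup {b : ℝ | ∃ c : ℝ, ν ≤ c ∧
    Tendsto (fun n : ℕ =>
      FD (iid P n) (iid Q (⌊H P / H Q * n + b * Real.sqrt n⌋₊))) atTop (nhds c)}

section Finite

variable {α β ι : Type*}

/-- A finset of items of weight at most `m` and total weight at least `τ` contains a subset whose
weight lies in `[τ, τ + m]`. -/
theorem exists_subset_sum_between (S : Finset α) (p : α → ℝ) {m τ : ℝ} (hm : 0 ≤ m)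
    (hpm : ∀ x ∈ S, p x ≤ m) (hτ : τ ≤ ∑ x ∈ S, p x) (hτ0 : 0 ≤ τ) :
    ∃ U ⊆ S, τ ≤ ∑ x ∈ U, p x ∧ ∑ x ∈ U, p x ≤ τ + m := by
  classical
  induction S using Finset.induction_on with
  | empty => exact ⟨∅, by simp, hτ, by simp only [Finset.sum_empty]; positivity⟩
  | insert a S ha ih =>
    by_cases h : τ ≤ ∑ x ∈ S, p x
    · obtain ⟨U, hU, h1, h2⟩ := ih (fun x hx => hpm x (Finset.mem_insert_of_mem hx)) h
      exact ⟨U, hU.trans (Finset.subset_insert _ _), h1, h2⟩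
    · refine ⟨insert a S, subset_rfl, hτ, ?_⟩
      rw [Finset.sum_insert ha]
      have := hpm a (Finset.mem_insert_self _ _)
      linarith

open Classical in
/-- Bins `y ∈ T` with demands `τ y` can be filled by items `x ∈ S` of weight at most `m y`, provided
that the total weight of the items is at least `∑ y ∈ T, (τ y + m y)`. -/
theorem exists_map_fill [Nonempty β] (T : Finset β) (p : α → ℝ) (hp : ∀ x, 0 ≤ p x)
    (τ m : β → ℝ) (hτ : ∀ y, 0 ≤ τ y) (hm : ∀ y, 0 ≤ m y) (S : Finset α)
    (hpm : ∀ x ∈ S, ∀ y ∈ T, p x ≤ m y) (hS : ∑ y ∈ T, (τ y + m y) ≤ ∑ x ∈ S, p x) :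
    ∃ W : α → β, ∀ y ∈ T, τ y ≤ ∑ x ∈ S with W x = y, p x := by
  induction T using Finset.induction_on generalizing S with
  | empty => exact ⟨fun _ => Classical.arbitrary β, by simp⟩
  | insert b T hb ih =>
    rw [Finset.sum_insert hb] at hS
    have hT : 0 ≤ ∑ y ∈ T, (τ y + m y) :=
      Finset.sum_nonneg fun y _ => add_nonneg (hτ y) (hm y)
    obtain ⟨U, hUS, hU1, hU2⟩ := exists_subset_sum_between S p (hm b)
      (fun x hx => hpm x hx b (Finset.mem_insert_self _ _)) (τ := τ b)
      (by linarith [hm b]) (hτ b)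
    have hsd := Finset.sum_sdiff hUS (f := p)
    obtain ⟨W, hW⟩ := ih (S \ U)
      (fun x hx y hy => hpm x (Finset.mem_sdiff.1 hx).1 y (Finset.mem_insert_of_mem hy))
      (by linarith)
    refine ⟨fun x => if x ∈ U then b else W x, fun y hy => ?_⟩
    rcases Finset.mem_insert.1 hy with rfl | hy
    · refine hU1.trans (Finset.sum_le_sum_of_subset_of_nonneg (fun x hx => ?_)
        fun x _ _ => hp x)
      simp [hx, hUS hx]
    · refine (hW y hy).trans (Finset.sum_le_sum_of_subset_of_nonneg (fun x hx => ?_)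
        fun x _ _ => hp x)
      simp only [Finset.mem_filter, Finset.mem_sdiff] at hx
      simp [hx.1.1, hx.1.2, hx.2]

variable [Fintype α]

theorem push_nonneg {p : α → ℝ} (hp : ∀ x, 0 ≤ p x) (W : α → β) (y : β) : 0 ≤ push W p y :=
  Finset.sum_nonneg fun x _ => by split_ifs <;> simp [hp x]

open Classical in
theorem push_eq_sum_filter (p : α → ℝ) (W : α → β) (y : β) :
    push W p y = ∑ x with W x = y, p x := by
  simp [push, Finset.sum_filter]

theorem le_push {p : α → ℝ} (hp : ∀ x, 0 ≤ p x) (W : α → β) (x : α) : p x ≤ push W p (W x) := by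
  classical
  rw [push_eq_sum_filter]
  exact Finset.single_le_sum (f := p) (fun x _ => hp x) (by simp)

variable [Fintype β]

theorem sum_push_mul (p : α → ℝ) (W : α → β) (f : β → ℝ) :
    ∑ y, push W p y * f y = ∑ x, p x * f (W x) := by
  classical
  simp only [push, Finset.sum_mul, ite_mul, zero_mul]
  rw [Finset.sum_comm]
  simp

theorem isProb_push {p : α → ℝ} (hp : IsProb p) (W : α → β) : IsProb (push W p) :=
  ⟨push_nonneg hp.1 W, by simpa [hp.2] using sum_push_mul p W fun _ => 1⟩

theorem isProb_iid {p : α → ℝ} (hp : IsProb p) (n : ℕ) : IsProb (iid p n) := by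
  classical
  refine ⟨fun f => Finset.prod_nonneg fun i _ => hp.1 _, ?_⟩
  have := Finset.prod_univ_sum (fun _ : Fin n => (Finset.univ : Finset α)) fun _ a => p a
  simp only [hp.2, Finset.prod_const_one, Fintype.piFinset_univ] at this
  exact this.symm

theorem IsProb.nonempty {p : α → ℝ} (hp : IsProb p) : Nonempty α := by
  by_contra h
  rw [not_nonempty_iff] at h
  simpa using hp.2

theorem fid_push_le_FD (p : α → ℝ) (q : β → ℝ) (W : α → β) : fid (push W p) q ≤ FD p q := by
  refine le_csSup ?_ ⟨W, rfl⟩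
  have : {r : ℝ | ∃ W : α → β, r = fid (push W p) q} =
      Set.range fun W : α → β => fid (push W p) q := by
    ext; simp [eq_comm]
  rw [this]
  exact (Set.finite_range _).bddAbove

theorem FD_le [Nonempty β] {p : α → ℝ} {q : β → ℝ} {r : ℝ}
    (h : ∀ W : α → β, fid (push W p) q ≤ r) : FD p q ≤ r := by
  refine csSup_le ⟨_, fun _ => Classical.arbitrary β, rfl⟩ ?_
  rintro _ ⟨W, rfl⟩
  exact h W

/-- Fidelity does not decrease under deterministic processing. -/
theorem fid_le_fid_push {γ : Type*} [Fintype γ] {R S : β → ℝ} (hR : ∀ y, 0 ≤ R y)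
    (hS : ∀ y, 0 ≤ S y) (g : β → γ) : fid R S ≤ fid (push g R) (push g S) := by
  classical
  unfold fid
  rw [← Finset.sum_fiberwise (s := Finset.univ) (g := g)]
  refine Finset.sum_le_sum fun z _ => ?_
  simp_rw [push_eq_sum_filter]
  simp_rw [fun y => Real.sqrt_mul (hR y) (S y)]
  rw [Real.sqrt_mul (Finset.sum_nonneg fun y _ => hR y)]
  have := Real.sum_sqrt_mul_sqrt_le (f := R) (g := S) (Finset.univ.filter fun y => g y = z) hR hS
  exact this

theorem push_push {γ : Type*} [Fintype γ] (p : α → ℝ) (W : α → β) (g : β → γ) :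
    push g (push W p) = push (g ∘ W) p := by
  classical
  ext z
  have h1 := sum_push_mul p W fun y => if g y = z then (1 : ℝ) else 0
  simpa [push] using h1

theorem push_init_iid {q : β → ℝ} (hq : IsProb q) (L : ℕ) :
    push (fun y : Fin (L + 1) → β => fun i : Fin L => y i.castSucc) (iid q (L + 1)) =
      iid q L := by
  classical
  ext z
  unfold push
  rw [← (Fin.snocEquiv (fun _ : Fin (L + 1) => β)).sum_comp, Fintype.sum_prod_type,
    Finset.sum_comm]
  simp [Fin.snocEquiv, iid, Fin.prod_univ_castSucc, ← Finset.mul_sum, hq.2]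

theorem FD_iid_antitone {p : α → ℝ} {q : β → ℝ} (hp : IsProb p) (hq : IsProb q) :
    Antitone fun L => FD p (iid q L) := by
  refine antitone_nat_of_succ_le fun L => ?_
  have := (isProb_iid hq (L + 1)).nonempty
  refine FD_le fun W => ?_
  refine (fid_le_fid_push (push_nonneg hp.1 W) (isProb_iid hq (L + 1)).1
    (fun y i => y (Fin.castSucc i))).trans ?_
  rw [push_init_iid hq, push_push]
  exact fid_push_le_FD _ _ _

/-- Converse bound on the fidelity through a monotone multiplier `lam` of the surprisal. -/
theorem two_mul_fid_push_le {p : α → ℝ} {q : β → ℝ} (hp : IsProb p) (hq : IsProb q) (W : α → β)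
    {lam : ℝ → ℝ} (hlam : Monotone lam) {m : ℝ} (hm : 0 < m) (hmlam : ∀ t, m ≤ lam t)
    (c : ℝ) {s ε : ℝ} (hs : 0 < s) :
    2 * fid (push W p) q ≤ ∑ x, p x * lam (s * (-Real.log (p x) - c)) +
      (∑ y, q y * (lam (s * (-Real.log (q y) - c) - ε))⁻¹ + m⁻¹ * Real.exp (-(ε / s))) := by
  set p' := push W p with hp'
  have hp'P : IsProb p' := isProb_push hp W
  set T : β → ℝ := fun y => s * (-Real.log (p' y) - c) with hT
  have hpos : ∀ t, 0 < lam t := fun t => hm.trans_le (hmlam t)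
  have h1 : ∑ y, p' y * lam (T y) ≤ ∑ x, p x * lam (s * (-Real.log (p x) - c)) := by
    rw [hp', sum_push_mul]
    refine Finset.sum_le_sum fun x _ => ?_
    rcases (hp.1 x).eq_or_lt with h | h
    · simp [← h]
    · refine mul_le_mul_of_nonneg_left (hlam ?_) (hp.1 x)
      refine mul_le_mul_of_nonneg_left ?_ hs.le
      have := Real.log_le_log h (le_push hp.1 W x)
      simp only [hp'] at this ⊢
      linarith
  have h2 : ∀ y, 2 * √(p' y * q y) ≤ p' y * lam (T y) +
      (q y * (lam (s * (-Real.log (q y) - c) - ε))⁻¹ +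
        m⁻¹ * Real.exp (-(ε / s)) * p' y) := by
    intro y
    have hq0 := hq.1 y
    have hp0 := hp'P.1 y
    have hl1 := hpos (T y)
    have hl2 := hpos (s * (-Real.log (q y) - c) - ε)
    have hnn1 : 0 ≤ p' y * lam (T y) := by positivity
    have hnn2 : 0 ≤ q y * (lam (s * (-Real.log (q y) - c) - ε))⁻¹ := by positivity
    have hnn3 : 0 ≤ m⁻¹ * Real.exp (-(ε / s)) * p' y := by positivity
    rcases hp0.eq_or_lt with h | hp0'
    · rw [← h]; simp; positivity
    rcases hq0.eq_or_lt with h | hq0'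
    · rw [← h]; simp; positivity
    have amgm : 2 * √(p' y * q y) ≤ p' y * lam (T y) + q y * (lam (T y))⁻¹ := by
      have e : p' y * q y = (p' y * lam (T y)) * (q y * (lam (T y))⁻¹) := by
        field_simp
      rw [e, Real.sqrt_mul hnn1]
      nlinarith [sq_nonneg (√(p' y * lam (T y)) - √(q y * (lam (T y))⁻¹)),
        Real.sq_sqrt hnn1, Real.sq_sqrt (show 0 ≤ q y * (lam (T y))⁻¹ by positivity)]
    by_cases hc : s * (-Real.log (q y) - c) - ε ≤ T y
    · have : (lam (T y))⁻¹ ≤ (lam (s * (-Real.log (q y) - c) - ε))⁻¹ :=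
        inv_anti₀ hl2 (hlam hc)
      have := mul_le_mul_of_nonneg_left this hq0
      linarith
    · have hlt : Real.log (q y) ≤ Real.log (p' y) + -(ε / s) := by
        rw [not_le] at hc
        simp only [hT] at hc
        have : s * (-Real.log (p' y) - c) < s * (-Real.log (q y) - c - ε / s) := by
          rw [mul_sub s _ (ε / s), mul_div_cancel₀ _ hs.ne']; exact hc
        have := lt_of_mul_lt_mul_left this hs.le
        linarith
      have hqp : q y ≤ p' y * Real.exp (-(ε / s)) := by
        have := Real.exp_le_exp.2 hlt
        rwa [Real.exp_add, Real.exp_log hq0', Real.exp_log hp0'] at this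
      have h3 : q y * (lam (T y))⁻¹ ≤ (p' y * Real.exp (-(ε / s))) * m⁻¹ :=
        mul_le_mul hqp (inv_anti₀ hm (hmlam _)) (by positivity) (by positivity)
      linarith
  have h3 := Finset.sum_le_sum fun y (_ : y ∈ Finset.univ) => h2 y
  rw [← Finset.mul_sum, Finset.sum_add_distrib, Finset.sum_add_distrib, ← Finset.mul_sum,
    hp'P.2, mul_one] at h3
  exact h3.trans (add_le_add_left h1 _)

/-- Achievability: a family of blocks of `q` is filled by blocks of `p` with much smaller atoms. -/
theorem mul_sum_sqrt_le_FD {p : α → ℝ} {q : β → ℝ} (hp : IsProb p) (hq : IsProb q) [Fintype ι]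
    (S : ι → Finset α) (T : ι → Finset β) (hS : Pairwise (Function.onFun Disjoint S))
    (hT : Pairwise (Function.onFun Disjoint T)) {δ : ℝ} (hδ0 : 0 ≤ δ) (hδ1 : δ ≤ 1)
    (h : ∀ i, ∀ x ∈ S i, ∀ y ∈ T i,
      p x * ∑ z ∈ T i, q z ≤ δ * (∑ z ∈ S i, p z) * q y) :
    (1 - δ) * ∑ i, √((∑ x ∈ S i, p x) * ∑ y ∈ T i, q y) ≤ FD p q := by
  classical
  have hne := hq.nonempty
  set a : ι → ℝ := fun i => ∑ x ∈ S i, p x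
  set b : ι → ℝ := fun i => ∑ y ∈ T i, q y
  have ha : ∀ i, 0 ≤ a i := fun i => Finset.sum_nonneg fun x _ => hp.1 x
  have hb : ∀ i, 0 ≤ b i := fun i => Finset.sum_nonneg fun x _ => hq.1 x
  have hfill : ∀ i, ∃ W : α → β, 0 < b i → ∀ y ∈ T i,
      (1 - δ) * (a i / b i) * q y ≤ ∑ x ∈ S i with W x = y, p x := by
    intro i
    rcases (hb i).eq_or_lt with h0 | h0
    · exact ⟨fun _ => Classical.arbitrary β, fun h => absurd h (by simp [← h0])⟩
    obtain ⟨W, hW⟩ := exists_map_fill (T i) p hp.1 (fun y => (1 - δ) * (a i / b i) * q y)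
      (fun y => δ * (a i / b i) * q y)
      (fun y => mul_nonneg (mul_nonneg (by linarith) (div_nonneg (ha i) (hb i))) (hq.1 y))
      (fun y => mul_nonneg (mul_nonneg hδ0 (div_nonneg (ha i) (hb i))) (hq.1 y)) (S i)
      (fun x hx y hy => by
        have := h i x hx y hy
        rw [show δ * (a i / b i) * q y = (δ * a i * q y) / b i by ring, le_div_iff₀ h0]
        exact this)
      (by
        have : ∀ y, (1 - δ) * (a i / b i) * q y + δ * (a i / b i) * q y =
          (a i / b i) * q y := fun y => by ring
        simp_rw [this]
        rw [← Finset.mul_sum]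
        exact (div_mul_cancel₀ (a i) h0.ne').le)
    exact ⟨W, fun _ => hW⟩
  choose W hW using hfill
  let V : α → β := fun x => if hx : ∃ i, x ∈ S i then W hx.choose x else Classical.arbitrary β
  have hV : ∀ i, ∀ x ∈ S i, V x = W i x := by
    intro i x hx
    have hex : ∃ i, x ∈ S i := ⟨i, hx⟩
    have : hex.choose = i := by
      by_contra hne
      exact Finset.disjoint_left.1 (hS hne) hex.choose_spec hx
    simp only [V, dif_pos hex, this]
  refine le_trans ?_ (fid_push_le_FD p q V)
  calc (1 - δ) * ∑ i, √(a i * b i)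
      ≤ ∑ i, ∑ y ∈ T i, √(push V p y * q y) := by
        rw [Finset.mul_sum]
        refine Finset.sum_le_sum fun i _ => ?_
        rcases (hb i).eq_or_lt with h0 | h0
        · simp only [← h0, mul_zero, Real.sqrt_zero]
          exact Finset.sum_nonneg fun y _ => Real.sqrt_nonneg _
        have key : ∀ y ∈ T i, (1 - δ) * √(a i / b i) * q y ≤ √(push V p y * q y) := by
          intro y hy
          apply Real.le_sqrt_of_sq_le
          have h1 : (1 - δ) * (a i / b i) * q y ≤ push V p y := by
            refine (hW i h0 y hy).trans ?_
            rw [push_eq_sum_filter]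
            refine Finset.sum_le_sum_of_subset_of_nonneg (fun x hx => ?_) fun x _ _ => hp.1 x
            rw [Finset.mem_filter] at hx
            simp [hV i x hx.1, hx.2]
          have hr : 0 ≤ a i / b i := div_nonneg (ha i) (hb i)
          have hq0 := hq.1 y
          rw [mul_pow, mul_pow, Real.sq_sqrt hr]
          have h2 : (1 - δ) ^ 2 ≤ 1 - δ := by nlinarith
          calc (1 - δ) ^ 2 * (a i / b i) * q y ^ 2
              ≤ (1 - δ) * (a i / b i) * q y ^ 2 := by gcongr
            _ = ((1 - δ) * (a i / b i) * q y) * q y := by ring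
            _ ≤ push V p y * q y := by gcongr
        refine le_trans (le_of_eq ?_) (Finset.sum_le_sum key)
        rw [← Finset.mul_sum, mul_assoc, Real.sqrt_div (ha i), Real.sqrt_mul (ha i)]
        have : √(b i) ^ 2 = b i := Real.sq_sqrt (hb i)
        have hs : 0 < √(b i) := Real.sqrt_pos.2 h0
        change _ = (1 - δ) * (√(a i) / √(b i) * b i)
        rw [div_mul_eq_mul_div, eq_comm]
        congr 1
        rw [div_eq_iff hs.ne', ← this]
        rw [Real.sqrt_sq hs.le]; ring
    _ = ∑ y ∈ Finset.univ.biUnion T, √(push V p y * q y) :=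
        (Finset.sum_biUnion fun i _ j _ hij => hT hij).symm
    _ ≤ fid (push V p) q :=
        Finset.sum_le_sum_of_subset_of_nonneg (Finset.subset_univ _)
          fun y _ _ => Real.sqrt_nonneg _

end Finite

section Law

open ProbabilityTheory Topology

variable {α β : Type*} [Fintype α]

/-- Law of the affinely normalized surprisal `s * (-log p(x) - c)` under the weights `p`. -/
noncomputable def infoLaw (p : α → ℝ) (c s : ℝ) : Measure ℝ :=
  ∑ x, ENNReal.ofReal (p x) • Measure.dirac (s * (-Real.log (p x) - c))

theorem isProbabilityMeasure_infoLaw {p : α → ℝ} (hp : IsProb p) (c s : ℝ) :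
    IsProbabilityMeasure (infoLaw p c s) := by
  constructor
  simp only [infoLaw, Measure.coe_finsetSum, Finset.sum_apply, Measure.smul_apply,
    measure_univ, smul_eq_mul, mul_one]
  rw [← ENNReal.ofReal_sum_of_nonneg fun x _ => hp.1 x, hp.2, ENNReal.ofReal_one]

theorem integral_infoLaw {E : Type*} [NormedAddCommGroup E] [NormedSpace ℝ E] [CompleteSpace E]
    {p : α → ℝ} (hp : IsProb p) (c s : ℝ) (f : ℝ → E) :
    ∫ t, f t ∂(infoLaw p c s) = ∑ x, p x • f (s * (-Real.log (p x) - c)) := by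
  rw [infoLaw, integral_finsetSum_measure]
  · refine Finset.sum_congr rfl fun x _ => ?_
    rw [integral_smul_measure, integral_dirac, ENNReal.toReal_ofReal (hp.1 x)]
  · intro x _
    exact (integrable_dirac (by simp)).smul_measure (by simp)

open Classical in
theorem infoLaw_real_apply {p : α → ℝ} (hp : IsProb p) (c s : ℝ) {A : Set ℝ}
    (hA : MeasurableSet A) :
    (infoLaw p c s).real A = ∑ x with s * (-Real.log (p x) - c) ∈ A, p x := by
  have := isProbabilityMeasure_infoLaw hp c s
  have h := integral_infoLaw hp c s (A.indicator fun _ => (1 : ℝ))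
  rw [integral_indicator hA] at h
  simp only [integral_const, smul_eq_mul, mul_one, measureReal_restrict_apply_univ] at h
  rw [h, Finset.sum_filter]
  simp [Set.indicator_apply]

theorem charFun_infoLaw {p : α → ℝ} (hp : IsProb p) (c s t : ℝ) :
    charFun (infoLaw p c s) t =
      ∑ x, (p x : ℂ) * Complex.exp (t * (s * (-Real.log (p x) - c)) * Complex.I) := by
  rw [charFun_apply_real, integral_infoLaw hp]
  simp

theorem charFun_infoLaw_iid {p : α → ℝ} (hp : IsProb p) (L : ℕ) (c s t d r : ℝ) (hr : r ≠ 0) :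
    charFun (infoLaw (iid p L) c s) t =
      Complex.exp (t * (s * (L * d - c)) * Complex.I) *
        charFun (infoLaw p d r) (s * t / r) ^ L := by
  classical
  rw [charFun_infoLaw (isProb_iid hp L), charFun_infoLaw hp]
  have hprod := Finset.prod_univ_sum (fun _ : Fin L => (Finset.univ : Finset α))
    fun _ x => (p x : ℂ) *
      Complex.exp (((s * t / r : ℝ) : ℂ) * (r * (-Real.log (p x) - d)) * Complex.I)
  rw [Finset.prod_const, Finset.card_univ, Fintype.card_fin, Fintype.piFinset_univ] at hprod
  rw [hprod, Finset.mul_sum]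
  refine Finset.sum_congr rfl fun x _ => ?_
  rw [Finset.prod_mul_distrib, ← Complex.exp_sum]
  by_cases h0 : ∃ i, p (x i) = 0
  · obtain ⟨i, hi⟩ := h0
    have h1 : ∏ i, (p (x i) : ℂ) = 0 := Finset.prod_eq_zero (Finset.mem_univ i) (by simp [hi])
    have h2 : iid p L x = 0 := Finset.prod_eq_zero (Finset.mem_univ i) hi
    simp [h1, h2]
  · push Not at h0
    have hlog : Real.log (iid p L x) = ∑ i, Real.log (p (x i)) :=
      Real.log_prod fun i _ => h0 i
    rw [hlog]
    have hcast : ((iid p L x : ℝ) : ℂ) = ∏ i, (p (x i) : ℂ) := by simp [iid]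
    rw [hcast, mul_left_comm (Complex.exp _), ← Complex.exp_add]
    congr 2
    rw [← Finset.sum_mul, ← add_mul]
    congr 1
    have hr' : (r : ℂ) ≠ 0 := by exact_mod_cast hr
    have : ∀ i, ((s * t / r : ℝ) : ℂ) * (r * (-Real.log (p (x i)) - d)) =
        t * (s * (-Real.log (p (x i)))) - t * s * d := by
      intro i; push_cast; field_simp
    simp_rw [this]
    rw [Finset.sum_sub_distrib, ← Finset.mul_sum, ← Finset.mul_sum]
    simp
    ring

/-- `(1 + zₙ) ^ Lₙ → exp w` when `zₙ → 0` and `Lₙ zₙ → w`. -/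
theorem tendsto_one_add_pow_exp {z : ℕ → ℂ} {L : ℕ → ℕ} {w : ℂ} (hz : Tendsto z atTop (𝓝 0))
    (hL : Tendsto (fun n => L n * z n) atTop (𝓝 w)) :
    Tendsto (fun n => (1 + z n) ^ L n) atTop (𝓝 (Complex.exp w)) := by
  have hder : HasDerivAt Complex.log (1 : ℂ)⁻¹ 1 :=
    Complex.hasDerivAt_log (by simp)
  have hd : Tendsto (fun n => L n * Complex.log (1 + z n)) atTop (𝓝 w) := by
    have hlo := hder.isLittleO
    have hcomp := hlo.comp_tendsto (show Tendsto (fun n => 1 + z n) atTop (𝓝 1) by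
      simpa using hz.const_add 1)
    have h1 : Tendsto (fun n => L n * (Complex.log (1 + z n) - z n)) atTop (𝓝 0) := by
      have h2 : (fun n => (L n : ℂ) * (Complex.log (1 + z n) - z n)) =o[atTop]
          fun n => (L n : ℂ) * z n := by
        refine (Asymptotics.isBigO_refl _ _).mul_isLittleO ?_
        simpa [Function.comp_def] using hcomp
      exact (h2.trans_isBigO (hL.isBigO_one ℂ)).tendsto_zero_of_tendsto tendsto_const_nhds
    have := h1.add hL
    simp only [zero_add] at this
    refine this.congr fun n => by ring
  refine (hd.cexp).congr' ?_
  have hne : ∀ᶠ n in atTop, 1 + z n ≠ 0 := by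
    have : Tendsto (fun n => 1 + z n) atTop (𝓝 1) := by simpa using hz.const_add 1
    exact this.eventually_ne one_ne_zero
  filter_upwards [hne] with n hn
  rw [Complex.exp_nat_mul, Complex.exp_log hn]

theorem sum_mul_surprisal_sub_H {p : α → ℝ} (hp : IsProb p) :
    ∑ x, p x * (-Real.log (p x) - H p) = 0 := by
  simp only [mul_sub, Finset.sum_sub_distrib, ← Finset.sum_mul, hp.2, one_mul, mul_neg]
  simp [H]

theorem tendsto_charFun_infoLaw_iid {p : α → ℝ} (hp : IsProb p) (hV : 0 < V p) {L : ℕ → ℕ}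
    {c s : ℕ → ℝ} {κ m : ℝ} (hs : Tendsto s atTop (𝓝 0))
    (hκ : Tendsto (fun n => L n * s n ^ 2) atTop (𝓝 κ))
    (hm : Tendsto (fun n => s n * (L n * H p - c n)) atTop (𝓝 m)) (t : ℝ) :
    Tendsto (fun n => charFun (infoLaw (iid p (L n)) (c n) (s n)) t) atTop
      (𝓝 (Complex.exp (t * m * Complex.I - (κ * V p : ℝ) * t ^ 2 / 2))) := by
  set σ := √(V p)
  have hσ : 0 < σ := Real.sqrt_pos.2 hV
  have hσ2 : σ ^ 2 = V p := Real.sq_sqrt hV.le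
  set μ := infoLaw p (H p) σ⁻¹
  have hμ : IsProbabilityMeasure μ := isProbabilityMeasure_infoLaw hp _ _
  have htay : (fun t => charFun μ t - (1 - (t : ℂ) ^ 2 / 2)) =o[𝓝 0] fun t => t ^ 2 := by
    have := taylor_charFun_two (P := μ) (X := id) aemeasurable_id ?_ ?_
    · simpa using this
    · rw [integral_infoLaw hp]
      simp only [id, smul_eq_mul, mul_left_comm _ σ⁻¹]
      rw [← Finset.mul_sum, sum_mul_surprisal_sub_H hp, mul_zero]
    · rw [integral_infoLaw hp]
      simp only [Pi.pow_apply, id, smul_eq_mul, mul_pow, mul_left_comm _ (σ⁻¹ ^ 2)]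
      rw [← Finset.mul_sum, inv_pow, hσ2]
      exact inv_mul_cancel₀ hV.ne'
  have hx : Tendsto (fun n => s n * t / σ⁻¹) atTop (𝓝 0) := by
    simpa using (hs.mul_const t).div_const σ⁻¹
  have hx2 : Tendsto (fun n => (L n : ℝ) * (s n * t / σ⁻¹) ^ 2) atTop (𝓝 (κ * V p * t ^ 2)) := by
    have := hκ.mul_const (V p * t ^ 2)
    rw [← mul_assoc] at this
    refine this.congr fun n => ?_
    rw [← hσ2]; field_simp
  have hzlim : Tendsto (fun n => (L n : ℂ) * (charFun μ (s n * t / σ⁻¹) - 1)) atTop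
      (𝓝 (-((κ * V p : ℝ) * t ^ 2 / 2))) := by
    have h1 := (htay.comp_tendsto hx)
    have h2 : (fun n => (L n : ℂ) *
        (charFun μ (s n * t / σ⁻¹) - (1 - ((s n * t / σ⁻¹ : ℝ) : ℂ) ^ 2 / 2))) =o[atTop]
          fun n => (L n : ℝ) * (s n * t / σ⁻¹) ^ 2 := by
      refine Asymptotics.IsBigO.mul_isLittleO ?_ h1
      exact Asymptotics.isBigO_of_le _ fun n => by simp
    have h3 := (h2.trans_isBigO (hx2.isBigO_one ℝ)).tendsto_zero_of_tendsto
      tendsto_const_nhds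
    have h4 : Tendsto (fun n => -((((L n : ℝ) * (s n * t / σ⁻¹) ^ 2 : ℝ) : ℂ) / 2)) atTop
        (𝓝 (-(((κ * V p * t ^ 2 : ℝ) : ℂ) / 2))) :=
      (((Complex.continuous_ofReal.tendsto _).comp hx2).div_const 2).neg
    have h5 := h3.add h4
    simp only [zero_add] at h5
    refine (h5.congr fun n => ?_).trans_eq ?_
    · push_cast; ring
    · push_cast; rfl
  have hz : Tendsto (fun n => charFun μ (s n * t / σ⁻¹) - 1) atTop (𝓝 0) := by
    have hc : Continuous (charFun μ) := continuous_charFun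
    have := ((hc.tendsto 0).comp hx).sub_const 1
    simpa using this
  have hpow := tendsto_one_add_pow_exp hz hzlim
  have hexp : Tendsto (fun n => Complex.exp (t * ((s n * (L n * H p - c n) : ℝ) : ℂ) * Complex.I))
      atTop (𝓝 (Complex.exp (t * m * Complex.I))) :=
    ((((Complex.continuous_ofReal.tendsto _).comp hm).const_mul _).mul_const _).cexp
  have := hexp.mul hpow
  rw [← Complex.exp_add, ← sub_eq_add_neg] at this
  refine this.congr fun n => ?_
  rw [charFun_infoLaw_iid hp (L n) (c n) (s n) t (H p) σ⁻¹ (inv_pos.2 hσ).ne']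
  simp [μ]

/-- Central limit theorem for the normalized surprisal of i.i.d. products. -/
theorem tendsto_infoLaw_iid {p : α → ℝ} (hp : IsProb p) (hV : 0 < V p) {L : ℕ → ℕ}
    {c s : ℕ → ℝ} {κ m : ℝ} (hκ0 : 0 ≤ κ) (hs : Tendsto s atTop (𝓝 0))
    (hκ : Tendsto (fun n => L n * s n ^ 2) atTop (𝓝 κ))
    (hm : Tendsto (fun n => s n * (L n * H p - c n)) atTop (𝓝 m)) :
    Tendsto (β := ProbabilityMeasure ℝ) (fun n => ⟨infoLaw (iid p (L n)) (c n) (s n),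
        isProbabilityMeasure_infoLaw (isProb_iid hp (L n)) _ _⟩) atTop
      (𝓝 ⟨gaussianReal m (κ * V p).toNNReal, inferInstance⟩) := by
  refine ProbabilityMeasure.tendsto_iff_tendsto_charFun.2 fun t => ?_
  have := tendsto_charFun_infoLaw_iid hp hV hs hκ hm t
  simp only [ProbabilityMeasure.coe_mk]
  rw [charFun_gaussianReal]
  rwa [← Real.coe_toNNReal _ (mul_nonneg hκ0 hV.le)] at this

variable {μ : ℕ → Measure ℝ} {μ₀ : Measure ℝ} [h : ∀ n, IsProbabilityMeasure (μ n)]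
  [h₀ : IsProbabilityMeasure μ₀]

theorem tendsto_integral_of_tendsto_law
    (hlim : Tendsto (β := ProbabilityMeasure ℝ) (fun n => ⟨μ n, h n⟩) atTop (𝓝 ⟨μ₀, h₀⟩))
    {f : ℝ → ℝ} (hf : Continuous f) {C : ℝ} (hC : ∀ t, |f t| ≤ C) :
    Tendsto (fun n => ∫ t, f t ∂(μ n)) atTop (𝓝 (∫ t, f t ∂μ₀)) :=
  ProbabilityMeasure.tendsto_iff_forall_integral_tendsto.1 hlim
    (BoundedContinuousFunction.ofNormedAddCommGroup f hf C hC)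

theorem tendsto_real_Ico_of_tendsto_law [NullSingletonClass μ₀]
    (hlim : Tendsto (β := ProbabilityMeasure ℝ) (fun n => ⟨μ n, h n⟩) atTop (𝓝 ⟨μ₀, h₀⟩))
    (a b : ℝ) :
    Tendsto (fun n => (μ n).real (Set.Ico a b)) atTop (𝓝 (μ₀.real (Set.Ico a b))) := by
  have := ProbabilityMeasure.tendsto_measure_of_null_frontier_of_tendsto' hlim
    (E := Set.Ico a b) ?_
  · exact (ENNReal.tendsto_toReal (measure_ne_top _ _)).comp this
  · rcases lt_or_ge a b with hab | hab
    · simp only [frontier_Ico hab, ProbabilityMeasure.coe_mk]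
      exact (Set.toFinite _).measure_zero _
    · simp [Set.Ico_eq_empty_of_le hab]

end Law

section Asymptotic

open ProbabilityTheory Topology

variable {α β : ℕ → Type*} [∀ n, Fintype (α n)] [∀ n, Fintype (β n)]
  {p : ∀ n, α n → ℝ} {q : ∀ n, β n → ℝ} {c s : ℕ → ℝ} {μP μQ : Measure ℝ}
  [hμP : IsProbabilityMeasure μP] [hμQ : IsProbabilityMeasure μQ]

theorem tendsto_exp_neg_div (hs : Tendsto s atTop (𝓝 0)) (hs0 : ∀ᶠ n in atTop, 0 < s n) {ε : ℝ}
    (hε : 0 < ε) : Tendsto (fun n => Real.exp (-(ε / s n))) atTop (𝓝 0) := by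
  have h1 : Tendsto s atTop (𝓝[>] 0) := tendsto_nhdsWithin_iff.2 ⟨hs, hs0⟩
  have h2 := h1.inv_tendsto_nhdsGT_zero.const_mul_atTop hε
  exact Real.tendsto_exp_neg_atTop_nhds_zero.comp (by simpa [div_eq_mul_inv] using h2)

/-- Asymptotic converse bound on the optimal fidelity. -/
theorem eventually_FD_le (hp : ∀ n, IsProb (p n)) (hq : ∀ n, IsProb (q n))
    (hs : Tendsto s atTop (𝓝 0)) (hs0 : ∀ᶠ n in atTop, 0 < s n)
    (hP : Tendsto (β := ProbabilityMeasure ℝ)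
      (fun n => ⟨infoLaw (p n) (c n) (s n), isProbabilityMeasure_infoLaw (hp n) _ _⟩) atTop
      (𝓝 ⟨μP, hμP⟩))
    (hQ : Tendsto (β := ProbabilityMeasure ℝ)
      (fun n => ⟨infoLaw (q n) (c n) (s n), isProbabilityMeasure_infoLaw (hq n) _ _⟩) atTop
      (𝓝 ⟨μQ, hμQ⟩))
    {lam : ℝ → ℝ} (hlam : Monotone lam) (hcont : Continuous lam) {m M : ℝ} (hm : 0 < m)
    (hmlam : ∀ t, m ≤ lam t) (hMlam : ∀ t, lam t ≤ M) {η : ℝ} (hη : 0 < η) :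
    ∀ᶠ n in atTop, 2 * FD (p n) (q n) ≤ ∫ t, lam t ∂μP + ∫ t, (lam t)⁻¹ ∂μQ + η := by
  have hpos : ∀ t, 0 < lam t := fun t => hm.trans_le (hmlam t)
  have hshift : Tendsto (fun ε => ∫ t, (lam (t - ε))⁻¹ ∂μQ) (𝓝[>] 0)
      (𝓝 (∫ t, (lam t)⁻¹ ∂μQ)) := by
    refine tendsto_integral_filter_of_dominated_convergence (fun _ => m⁻¹) ?_ ?_
      (integrable_const _) ?_
    · refine Eventually.of_forall fun ε => ?_
      exact ((hcont.comp (continuous_id.sub continuous_const)).inv₀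
        fun t => (hpos _).ne').aestronglyMeasurable
    · refine Eventually.of_forall fun ε => Eventually.of_forall fun t => ?_
      rw [Real.norm_of_nonneg (inv_pos.2 (hpos _)).le]
      exact inv_anti₀ hm (hmlam _)
    · refine Eventually.of_forall fun t => ?_
      have hc : Continuous fun ε => (lam (t - ε))⁻¹ :=
        (hcont.comp (continuous_const.sub continuous_id)).inv₀ fun t => (hpos _).ne'
      have := hc.tendsto 0
      simp only [sub_zero] at this
      exact this.mono_left nhdsWithin_le_nhds
  obtain ⟨ε, hε, hε0⟩ := ((hshift.eventually_lt_const
    (show _ < ∫ t, (lam t)⁻¹ ∂μQ + η by linarith)).and self_mem_nhdsWithin).exists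
  have hε0 : 0 < ε := hε0
  have inst1 := fun n => isProbabilityMeasure_infoLaw (hp n) (c n) (s n)
  have inst2 := fun n => isProbabilityMeasure_infoLaw (hq n) (c n) (s n)
  have l1 := tendsto_integral_of_tendsto_law hP hcont (C := M) fun t => by
    rw [abs_of_pos (hpos t)]; exact hMlam t
  have l2 := tendsto_integral_of_tendsto_law hQ (f := fun t => (lam (t - ε))⁻¹)
    ((hcont.comp (continuous_id.sub continuous_const)).inv₀ fun t => (hpos _).ne')
    (C := m⁻¹) fun t => by
      rw [abs_of_pos (inv_pos.2 (hpos _))]; exact inv_anti₀ hm (hmlam _)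
  have l3 := l1.add (l2.add ((tendsto_exp_neg_div hs hs0 hε0).const_mul m⁻¹))
  filter_upwards [l3.eventually_lt_const (show _ < ∫ t, lam t ∂μP + ∫ t, (lam t)⁻¹ ∂μQ + η by
    linarith), hs0] with n hn hsn
  have := (hq n).nonempty
  have key : FD (p n) (q n) ≤ (∫ t, lam t ∂μP + ∫ t, (lam t)⁻¹ ∂μQ + η) / 2 := by
    refine FD_le fun W => ?_
    have h1 := two_mul_fid_push_le (hp n) (hq n) W hlam hm hmlam (c n) hsn (ε := ε)
    simp only [integral_infoLaw (hp n), integral_infoLaw (hq n), smul_eq_mul] at hn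
    linarith
  linarith

/-- Asymptotic achievability: interval blocks of the limit law of `q` lying strictly below the
corresponding blocks of the limit law of `p` can be filled. -/
theorem eventually_le_FD [NullSingletonClass μP] [NullSingletonClass μQ] {ι : Type*} [Fintype ι]
    (hp : ∀ n, IsProb (p n)) (hq : ∀ n, IsProb (q n))
    (hs : Tendsto s atTop (𝓝 0)) (hs0 : ∀ᶠ n in atTop, 0 < s n)
    (hP : Tendsto (β := ProbabilityMeasure ℝ)
      (fun n => ⟨infoLaw (p n) (c n) (s n), isProbabilityMeasure_infoLaw (hp n) _ _⟩) atTop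
      (𝓝 ⟨μP, hμP⟩))
    (hQ : Tendsto (β := ProbabilityMeasure ℝ)
      (fun n => ⟨infoLaw (q n) (c n) (s n), isProbabilityMeasure_infoLaw (hq n) _ _⟩) atTop
      (𝓝 ⟨μQ, hμQ⟩))
    (a a' d d' : ι → ℝ) (hda : ∀ i, d' i < a i)
    (hA : Pairwise (Function.onFun Disjoint fun i => Set.Ico (a i) (a' i)))
    (hD : Pairwise (Function.onFun Disjoint fun i => Set.Ico (d i) (d' i)))
    (hpos : ∀ i, 0 < μP.real (Set.Ico (a i) (a' i))) {r : ℝ}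
    (hr : r < ∑ i, √(μP.real (Set.Ico (a i) (a' i)) * μQ.real (Set.Ico (d i) (d' i)))) :
    ∀ᶠ n in atTop, r ≤ FD (p n) (q n) := by
  classical
  set F := ∑ i, √(μP.real (Set.Ico (a i) (a' i)) * μQ.real (Set.Ico (d i) (d' i)))
  have inst1 := fun n => isProbabilityMeasure_infoLaw (hp n) (c n) (s n)
  have inst2 := fun n => isProbabilityMeasure_infoLaw (hq n) (c n) (s n)
  have lP := fun i => tendsto_real_Ico_of_tendsto_law hP (a i) (a' i)
  have lQ := fun i => tendsto_real_Ico_of_tendsto_law hQ (d i) (d' i)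
  have lsum : Tendsto (fun n => ∑ i, √((infoLaw (p n) (c n) (s n)).real (Set.Ico (a i) (a' i)) *
      (infoLaw (q n) (c n) (s n)).real (Set.Ico (d i) (d' i)))) atTop (𝓝 F) :=
    tendsto_finsetSum _ fun i _ => ((lP i).mul (lQ i)).sqrt
  obtain ⟨δ, hδr, hδ0, hδ1⟩ : ∃ δ : ℝ, r < (1 - δ) * F ∧ 0 < δ ∧ δ < 1 := by
    have h1 : Tendsto (fun δ : ℝ => (1 - δ) * F) (𝓝[>] 0) (𝓝 F) := by
      have : Continuous fun δ : ℝ => (1 - δ) * F := by fun_prop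
      simpa using (this.tendsto 0).mono_left nhdsWithin_le_nhds
    obtain ⟨δ, h1, h2⟩ := ((h1.eventually_const_lt hr).and
      (Ioo_mem_nhdsGT (show (0 : ℝ) < 1 by norm_num))).exists
    exact ⟨δ, h1, h2.1, h2.2⟩
  have hatom : ∀ᶠ n in atTop, ∀ i, Real.exp (-((a i - d' i) / s n)) ≤
      δ * (infoLaw (p n) (c n) (s n)).real (Set.Ico (a i) (a' i)) := by
    refine eventually_all.2 fun i => ?_
    have h1 := tendsto_exp_neg_div hs hs0 (sub_pos.2 (hda i))
    have h2 := (lP i).const_mul δ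
    exact (h1.eventually_lt h2 (mul_pos hδ0 (hpos i))).mono fun n hn => hn.le
  filter_upwards [(lsum.const_mul (1 - δ)).eventually_const_lt hδr, hatom, hs0] with n hn hat hsn
  refine hn.le.trans ?_
  let S : ι → Finset (α n) := fun i =>
    {x | s n * (-Real.log (p n x) - c n) ∈ Set.Ico (a i) (a' i)}
  let T : ι → Finset (β n) := fun i =>
    {y | s n * (-Real.log (q n y) - c n) ∈ Set.Ico (d i) (d' i) ∧ q n y ≠ 0}
  have hSsum : ∀ i, (infoLaw (p n) (c n) (s n)).real (Set.Ico (a i) (a' i)) =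
      ∑ x ∈ S i, p n x := fun i => by
    rw [infoLaw_real_apply (hp n) _ _ measurableSet_Ico]
    simp only [S]
    congr!
  have hTsum : ∀ i, (infoLaw (q n) (c n) (s n)).real (Set.Ico (d i) (d' i)) =
      ∑ y ∈ T i, q n y := fun i => by
    rw [infoLaw_real_apply (hq n) _ _ measurableSet_Ico, ← Finset.sum_filter_ne_zero,
      Finset.filter_filter]
    simp only [T]
    congr!
  simp_rw [hSsum, hTsum]
  refine mul_sum_sqrt_le_FD (hp n) (hq n) S T ?_ ?_ hδ0.le hδ1.le ?_
  · intro i j hij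
    refine Finset.disjoint_left.2 fun x hx hx' => ?_
    simp only [S, Finset.mem_filter] at hx hx'
    exact Set.disjoint_left.1 (hA hij) hx.2 hx'.2
  · intro i j hij
    refine Finset.disjoint_left.2 fun x hx hx' => ?_
    simp only [T, Finset.mem_filter] at hx hx'
    exact Set.disjoint_left.1 (hD hij) hx.2.1 hx'.2.1
  · intro i x hx y hy
    simp only [S, T, Finset.mem_filter, Finset.mem_univ, true_and, Set.mem_Ico] at hx hy
    have hq0 : 0 < q n y := lt_of_le_of_ne ((hq n).1 y) (Ne.symm hy.2)
    have hSnn : 0 ≤ ∑ z ∈ S i, p n z := Finset.sum_nonneg fun z _ => (hp n).1 z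
    rcases ((hp n).1 x).eq_or_lt with h0 | hp0
    · rw [← h0, zero_mul]
      positivity
    have hT1 : ∑ z ∈ T i, q n z ≤ 1 := by
      rw [← (hq n).2]
      exact Finset.sum_le_sum_of_subset_of_nonneg (Finset.subset_univ _)
        fun y _ _ => (hq n).1 y
    have hlog : Real.log (p n x) ≤ Real.log (q n y) + -((a i - d' i) / s n) := by
      have h1 : a i / s n ≤ -Real.log (p n x) - c n := by
        rw [div_le_iff₀ hsn, mul_comm]; exact hx.1
      have h2 : -Real.log (q n y) - c n ≤ d' i / s n := by
        rw [le_div_iff₀ hsn, mul_comm]; exact hy.1.2.le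
      rw [sub_div]
      linarith
    have hle := Real.exp_le_exp.2 hlog
    rw [Real.exp_add, Real.exp_log hp0, Real.exp_log hq0] at hle
    have h3 := hat i
    rw [hSsum] at h3
    calc p n x * ∑ z ∈ T i, q n z ≤ p n x * 1 := by gcongr
      _ ≤ q n y * Real.exp (-((a i - d' i) / s n)) := by rw [mul_one]; exact hle
      _ ≤ q n y * (δ * ∑ z ∈ S i, p n z) := by gcongr
      _ = _ := by ring

end Asymptotic

section Density

open ProbabilityTheory Topology Set

/-- `μ` has the continuous positive Lebesgue density `f`. -/
structure IsContDensity (f : ℝ → ℝ) (μ : Measure ℝ) : Prop where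
  continuous : Continuous f
  pos : ∀ x, 0 < f x
  integrable : Integrable f
  eq_withDensity : μ = volume.withDensity fun x => ENNReal.ofReal (f x)

/-- The ratio `f / g` increases strictly up to `x₀`, then decreases to `0`. -/
structure IsUnimodalRatio (f g : ℝ → ℝ) (x₀ : ℝ) : Prop where
  strictMonoOn : StrictMonoOn (fun x => f x / g x) (Iic x₀)
  antitoneOn : AntitoneOn (fun x => f x / g x) (Ici x₀)
  tendsto : Tendsto (fun x => f x / g x) atTop (𝓝 0)

variable {f g : ℝ → ℝ} {μ ν : Measure ℝ} {x₀ a b c x : ℝ} {s : Set ℝ}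

namespace IsContDensity

theorem real_apply (h : IsContDensity f μ) (hs : MeasurableSet s) :
    μ.real s = ∫ x in s, f x := by
  rw [measureReal_def, h.eq_withDensity, withDensity_apply _ hs,
    ← ofReal_integral_eq_lintegral_ofReal h.integrable.integrableOn
      (Eventually.of_forall fun x => (h.pos x).le),
    ENNReal.toReal_ofReal (integral_nonneg fun x => (h.pos x).le)]

theorem integral_eq (h : IsContDensity f μ) (w : ℝ → ℝ) : ∫ x, w x ∂μ = ∫ x, f x * w x := by
  rw [h.eq_withDensity, integral_withDensity_eq_integral_toReal_smul
    h.continuous.measurable.ennreal_ofReal (by simp)]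
  simp [ENNReal.toReal_ofReal (h.pos _).le]

theorem isFiniteMeasure (h : IsContDensity f μ) : IsFiniteMeasure μ := by
  rw [h.eq_withDensity]
  exact isFiniteMeasure_withDensity_ofReal h.integrable.2

theorem nullSingletonClass (h : IsContDensity f μ) : NullSingletonClass μ := by
  rw [h.eq_withDensity]
  infer_instance

theorem real_Iic_add (h : IsContDensity f μ) (hab : a ≤ b) :
    μ.real (Iic a) + μ.real (Ioc a b) = μ.real (Iic b) := by
  have := h.isFiniteMeasure
  rw [← measureReal_union (Iic_disjoint_Ioc le_rfl) measurableSet_Ioc, Iic_union_Ioc_eq_Iic hab]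

theorem real_Ico (h : IsContDensity f μ) (hab : a ≤ b) :
    μ.real (Ico a b) = μ.real (Iic b) - μ.real (Iic a) := by
  have := h.nullSingletonClass
  rw [measureReal_congr Ico_ae_eq_Ioc, ← h.real_Iic_add hab, add_sub_cancel_left]

theorem real_Ico_eq_intervalIntegral (h : IsContDensity f μ) (hab : a ≤ b) :
    μ.real (Ico a b) = ∫ x in a..b, f x := by
  rw [h.real_apply measurableSet_Ico, intervalIntegral.integral_of_le hab,
    integral_Ico_eq_integral_Ioc]

theorem real_Ico_pos (h : IsContDensity f μ) (hab : a < b) : 0 < μ.real (Ico a b) := by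
  rw [h.real_Ico_eq_intervalIntegral hab.le]
  exact intervalIntegral.intervalIntegral_pos_of_pos (h.continuous.intervalIntegrable _ _) h.pos hab

theorem strictMono_real_Iic (h : IsContDensity f μ) : StrictMono fun x => μ.real (Iic x) :=
  fun _ _ hab => sub_pos.1 (h.real_Ico hab.le ▸ h.real_Ico_pos hab)

theorem real_Iic_pos (h : IsContDensity f μ) (x : ℝ) : 0 < μ.real (Iic x) :=
  measureReal_nonneg.trans_lt (h.strictMono_real_Iic (sub_one_lt x))

theorem continuous_real_Iic (h : IsContDensity f μ) : Continuous fun x => μ.real (Iic x) := by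
  have : (fun x => μ.real (Iic x)) = fun x => μ.real (Iic 0) + ∫ t in (0 : ℝ)..x, f t := by
    ext x
    rw [h.real_apply measurableSet_Iic, h.real_apply measurableSet_Iic,
      ← intervalIntegral.integral_Iic_sub_Iic h.integrable.integrableOn h.integrable.integrableOn]
    ring
  rw [this]
  exact continuous_const.add
    (intervalIntegral.continuous_primitive (fun a b => h.continuous.intervalIntegrable a b) 0)

theorem exists_real_Iic_eq (h : IsContDensity f μ) [IsProbabilityMeasure μ] {y : ℝ} (hy : 0 < y)
    (hyx : y ≤ μ.real (Iic x)) : ∃ z ≤ x, μ.real (Iic z) = y := by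
  obtain ⟨z', hz', hzx⟩ :=
    (((tendsto_cdf_atBot μ).eventually_lt_const hy).and (eventually_le_atBot x)).exists
  obtain ⟨z, hz, hzy⟩ := intermediate_value_Icc hzx h.continuous_real_Iic.continuousOn
    ⟨by rw [← cdf_eq_real]; exact hz'.le, hyx⟩
  exact ⟨z, hz.2, hzy⟩

theorem real_le_mul (hf : IsContDensity f μ) (hg : IsContDensity g ν) (hs : MeasurableSet s)
    (h : ∀ x ∈ s, f x / g x ≤ c) : μ.real s ≤ c * ν.real s := by
  rw [hf.real_apply hs, hg.real_apply hs, ← integral_const_mul]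
  exact setIntegral_mono_on hf.integrable.integrableOn (hg.integrable.integrableOn.const_mul c) hs
    fun x hx => (div_le_iff₀ (hg.pos x)).1 (h x hx)

theorem mul_le_real (hf : IsContDensity f μ) (hg : IsContDensity g ν) (hs : MeasurableSet s)
    (h : ∀ x ∈ s, c ≤ f x / g x) : c * ν.real s ≤ μ.real s := by
  rw [hf.real_apply hs, hg.real_apply hs, ← integral_const_mul]
  exact setIntegral_mono_on (hg.integrable.integrableOn.const_mul c) hf.integrable.integrableOn hs
    fun x hx => (le_div_iff₀ (hg.pos x)).1 (h x hx)

theorem integrable_sqrt_mul (hf : IsContDensity f μ) (hg : IsContDensity g ν) :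
    Integrable fun x => √(f x * g x) := by
  refine (hf.integrable.add hg.integrable).mono'
    (hf.continuous.mul hg.continuous).sqrt.aestronglyMeasurable (Eventually.of_forall fun x => ?_)
  have h1 := hf.pos x
  have h2 := hg.pos x
  rw [Real.norm_of_nonneg (Real.sqrt_nonneg _)]
  refine (Real.sqrt_le_left (add_pos h1 h2).le).2 ?_
  nlinarith

theorem continuous_div (hf : IsContDensity f μ) (hg : IsContDensity g ν) :
    Continuous fun x => f x / g x :=
  hf.continuous.div hg.continuous fun x => (hg.pos x).ne'

end IsContDensity

theorem isContDensity_gaussianReal (m : ℝ) {v : NNReal} (hv : v ≠ 0) :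
    IsContDensity (gaussianPDFReal m v) (gaussianReal m v) where
  continuous := by unfold gaussianPDFReal; fun_prop
  pos x := gaussianPDFReal_pos m v x hv
  integrable := integrable_gaussianPDFReal m v
  eq_withDensity := gaussianReal_of_var_ne_zero m hv

theorem exists_isUnimodalRatio_gaussianPDFReal (m₁ m₂ : ℝ) {v₁ v₂ : NNReal} (h₁ : 0 < v₁)
    (h : v₁ < v₂) :
    ∃ x₀, IsUnimodalRatio (gaussianPDFReal m₁ v₁) (gaussianPDFReal m₂ v₂) x₀ := by
  have h1 : (0 : ℝ) < v₁ := h₁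
  have h12 : (v₁ : ℝ) < v₂ := h
  have h2 : (0 : ℝ) < v₂ := h1.trans h12
  obtain ⟨x₀, A, B, hA, hB, hr⟩ : ∃ x₀ A B : ℝ, 0 < A ∧ 0 < B ∧ ∀ x,
      gaussianPDFReal m₁ v₁ x / gaussianPDFReal m₂ v₂ x = B * Real.exp (-(A * (x - x₀) ^ 2)) := by
    have h3 : (0 : ℝ) < v₂ - v₁ := sub_pos.2 h12
    refine ⟨(v₂ * m₁ - v₁ * m₂) / (v₂ - v₁), (v₂ - v₁) / (2 * v₁ * v₂),
      (√(2 * Real.pi * v₁))⁻¹ / (√(2 * Real.pi * v₂))⁻¹ *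
        Real.exp ((m₁ - m₂) ^ 2 / (2 * (v₂ - v₁))), by positivity, by positivity, fun x => ?_⟩
    rw [gaussianPDFReal, gaussianPDFReal, mul_div_mul_comm, ← Real.exp_sub,
      mul_assoc (_ / _), ← Real.exp_add]
    congr 2
    field_simp
    ring
  refine ⟨x₀, ?_, ?_, ?_⟩
  · intro x hx y hy hxy
    simp only [hr]
    simp only [mem_Iic] at hx hy
    refine mul_lt_mul_of_pos_left (Real.exp_lt_exp.2 (neg_lt_neg ?_)) hB
    exact mul_lt_mul_of_pos_left (by nlinarith) hA
  · intro x hx y hy hxy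
    simp only [hr]
    simp only [mem_Ici] at hx hy
    gcongr
  · simp only [hr]
    have h4 : Tendsto (fun x : ℝ => A * (x - x₀) ^ 2) atTop atTop :=
      ((tendsto_pow_atTop two_ne_zero).comp
        (tendsto_atTop_add_const_right atTop (-x₀) tendsto_id)).const_mul_atTop hA
    simpa using (Real.tendsto_exp_neg_atTop_nhds_zero.comp h4).const_mul B

end Density

section Threshold

open ProbabilityTheory Topology Set

variable {f g : ℝ → ℝ} {μ ν : Measure ℝ} {x₀ x α : ℝ}

theorem IsUnimodalRatio.le_of_eq_div (hr : IsUnimodalRatio f g x₀) (hf : IsContDensity f μ)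
    (hg : IsContDensity g ν) (hα : f α / g α = μ.real (Iic α) / ν.real (Iic α)) : x₀ ≤ α := by
  by_contra! h
  have h1 : f (α - 1) / g (α - 1) < f α / g α :=
    hr.strictMonoOn (by simp only [mem_Iic]; linarith) h.le (sub_one_lt α)
  have h2 : μ.real (Iic (α - 1)) ≤ f (α - 1) / g (α - 1) * ν.real (Iic (α - 1)) :=
    hf.real_le_mul hg measurableSet_Iic fun y hy => by
      simp only [mem_Iic] at hy
      exact hr.strictMonoOn.monotoneOn (by simp only [mem_Iic]; linarith)
        (by simp only [mem_Iic]; linarith) hy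
  have h3 : μ.real (Ico (α - 1) α) ≤ f α / g α * ν.real (Ico (α - 1) α) :=
    hf.real_le_mul hg measurableSet_Ico fun y hy =>
      hr.strictMonoOn.monotoneOn (hy.2.le.trans h.le) h.le hy.2.le
  rw [hf.real_Ico (sub_one_lt α).le, hg.real_Ico (sub_one_lt α).le] at h3
  have h4 := (eq_div_iff (hg.real_Iic_pos α).ne').1 hα
  nlinarith [mul_lt_mul_of_pos_right h1 (hg.real_Iic_pos (α - 1))]

theorem IsUnimodalRatio.real_Iic_le (hr : IsUnimodalRatio f g x₀) (hf : IsContDensity f μ)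
    (hg : IsContDensity g ν) (hα : f α / g α = μ.real (Iic α) / ν.real (Iic α)) (hx : x ≤ α) :
    μ.real (Iic x) ≤ f α / g α * ν.real (Iic x) := by
  have hα0 := hr.le_of_eq_div hf hg hα
  by_cases h : x < x₀ ∧ f x / g x ≤ f α / g α
  · refine hf.real_le_mul hg measurableSet_Iic fun y hy => ?_
    exact (hr.strictMonoOn.monotoneOn (le_trans hy h.1.le) h.1.le hy).trans h.2
  · have h1 : f α / g α * ν.real (Ico x α) ≤ μ.real (Ico x α) := by
      refine hf.mul_le_real hg measurableSet_Ico fun y hy => ?_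
      rcases le_or_gt x₀ y with hy0 | hy0
      · exact hr.antitoneOn hy0 hα0 hy.2.le
      · have hx0 : x < x₀ := hy.1.trans_lt hy0
        have hx1 : f α / g α < f x / g x := by
          by_contra! h2
          exact h ⟨hx0, h2⟩
        exact hx1.le.trans (hr.strictMonoOn.monotoneOn hx0.le hy0.le hy.1)
    rw [hf.real_Ico hx, hg.real_Ico hx] at h1
    have h4 := (eq_div_iff (hg.real_Iic_pos α).ne').1 hα
    linarith

theorem IsUnimodalRatio.exists_eq_div [IsProbabilityMeasure μ] [IsProbabilityMeasure ν]
    (hr : IsUnimodalRatio f g x₀) (hf : IsContDensity f μ) (hg : IsContDensity g ν) :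
    ∃ α, f α / g α = μ.real (Iic α) / ν.real (Iic α) := by
  have hlim : Tendsto (fun x => f x / g x * ν.real (Iic x) - μ.real (Iic x)) atTop (𝓝 (-1)) := by
    have h1 := (tendsto_cdf_atTop μ).congr (cdf_eq_real μ)
    have h2 := (tendsto_cdf_atTop ν).congr (cdf_eq_real ν)
    simpa using (hr.tendsto.mul h2).sub h1
  obtain ⟨y, hy, hxy⟩ := ((hlim.eventually_lt_const (show (-1 : ℝ) < 0 by norm_num)).and
    (eventually_ge_atTop x₀)).exists
  have h0 : 0 ≤ f x₀ / g x₀ * ν.real (Iic x₀) - μ.real (Iic x₀) :=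
    sub_nonneg.2 (hf.real_le_mul hg measurableSet_Iic fun z hz =>
      hr.strictMonoOn.monotoneOn hz self_mem_Iic hz)
  obtain ⟨z, -, hz⟩ := intermediate_value_Icc' hxy
    (((hf.continuous_div hg).mul hg.continuous_real_Iic).sub hf.continuous_real_Iic).continuousOn
    ⟨hy.le, h0⟩
  exact ⟨z, (eq_div_iff (hg.real_Iic_pos z).ne').2 (sub_eq_zero.1 hz)⟩

/-- Fidelity of `μ` and `ν` after merging `(-∞, α]` into a single atom. -/
noncomputable def mergedFid (f g : ℝ → ℝ) (μ ν : Measure ℝ) (α : ℝ) : ℝ :=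
  √(μ.real (Iic α) * ν.real (Iic α)) + ∫ t in Ioi α, √(f t * g t)

theorem IsContDensity.integral_of_eqOn (hf : IsContDensity f μ) {φ ψ : ℝ → ℝ} {k : ℝ}
    (hψ : Integrable ψ) (h1 : ∀ t ≤ α, φ t = k * f t) (h2 : ∀ t, α < t → φ t = ψ t) :
    Integrable φ ∧ ∫ t, φ t = k * μ.real (Iic α) + ∫ t in Ioi α, ψ t := by
  have i1 : IntegrableOn φ (Iic α) := (hf.integrable.const_mul k).integrableOn.congr_fun
    (fun t ht => (h1 t ht).symm) measurableSet_Iic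
  have i2 : IntegrableOn φ (Ioi α) := hψ.integrableOn.congr_fun
    (fun t ht => (h2 t ht).symm) measurableSet_Ioi
  refine ⟨by rw [← integrableOn_univ, ← Iic_union_Ioi (a := α)]; exact i1.union i2, ?_⟩
  rw [← intervalIntegral.integral_Iic_add_Ioi i1 i2, setIntegral_congr_fun measurableSet_Iic h1,
    setIntegral_congr_fun measurableSet_Ioi h2, integral_const_mul,
    hf.real_apply measurableSet_Iic]

/-- Square root of the likelihood ratio, frozen to the left of `α`. -/
noncomputable def sqrtRatio (f g : ℝ → ℝ) (α t : ℝ) : ℝ :=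
  √(f (max t α) / g (max t α))

theorem sqrtRatio_pos (hf : IsContDensity f μ) (hg : IsContDensity g ν) (t : ℝ) :
    0 < sqrtRatio f g α t :=
  Real.sqrt_pos.2 (div_pos (hf.pos _) (hg.pos _))

theorem continuous_sqrtRatio (hf : IsContDensity f μ) (hg : IsContDensity g ν) :
    Continuous (sqrtRatio f g α) :=
  ((hf.continuous_div hg).comp (continuous_id.max continuous_const)).sqrt

theorem IsUnimodalRatio.antitone_sqrtRatio (hr : IsUnimodalRatio f g x₀) (hα : x₀ ≤ α) :
    Antitone (sqrtRatio f g α) := fun _ _ h =>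
  Real.sqrt_le_sqrt (hr.antitoneOn (hα.trans (le_max_right _ _)) (hα.trans (le_max_right _ _))
    (max_le_max h le_rfl))

theorem sqrtRatio_le (hr : IsUnimodalRatio f g x₀) (hα : x₀ ≤ α) (t : ℝ) :
    sqrtRatio f g α t ≤ √(f α / g α) :=
  Real.sqrt_le_sqrt (hr.antitoneOn hα (hα.trans (le_max_right _ _)) (le_max_right _ _))

theorem integral_sqrtRatio (hf : IsContDensity f μ) (hg : IsContDensity g ν)
    (hα : f α / g α = μ.real (Iic α) / ν.real (Iic α)) :
    ∫ t, sqrtRatio f g α t ∂ν = mergedFid f g μ ν α := by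
  rw [hg.integral_eq, (hg.integral_of_eqOn (α := α) (k := √(f α / g α))
    (hf.integrable_sqrt_mul hg) (fun t ht => ?_) fun t ht => ?_).2, mergedFid, hα]
  · congr 1
    have h1 := hf.real_Iic_pos α
    have h2 := hg.real_Iic_pos α
    rw [Real.sqrt_div h1.le, Real.sqrt_mul h1.le, div_mul_eq_mul_div, div_eq_iff (by positivity),
      mul_assoc, Real.mul_self_sqrt h2.le]
  · rw [sqrtRatio, max_eq_right ht, mul_comm]
  · have h1 := hf.pos t
    have h2 := hg.pos t
    rw [sqrtRatio, max_eq_left ht.le, Real.sqrt_div h1.le, Real.sqrt_mul h1.le, mul_div_assoc',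
      div_eq_iff (by positivity), mul_assoc, Real.mul_self_sqrt h2.le, mul_comm]

theorem integrable_and_integral_inv_sqrtRatio (hf : IsContDensity f μ) (hg : IsContDensity g ν)
    (hα : f α / g α = μ.real (Iic α) / ν.real (Iic α)) :
    Integrable (fun t => f t * (sqrtRatio f g α t)⁻¹) ∧
      ∫ t, f t * (sqrtRatio f g α t)⁻¹ = mergedFid f g μ ν α := by
  have key := hf.integral_of_eqOn (α := α) (k := (√(f α / g α))⁻¹)
    (φ := fun t => f t * (sqrtRatio f g α t)⁻¹)
    (hf.integrable_sqrt_mul hg) (fun t ht => ?_) fun t ht => ?_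
  · refine ⟨key.1, key.2.trans ?_⟩
    rw [mergedFid, hα]
    congr 1
    have h1 := hf.real_Iic_pos α
    have h2 := hg.real_Iic_pos α
    rw [Real.sqrt_div h1.le, Real.sqrt_mul h1.le, inv_div, div_mul_eq_mul_div,
      div_eq_iff (by positivity), mul_right_comm, Real.mul_self_sqrt h1.le, mul_comm]
  · rw [sqrtRatio, max_eq_right ht, mul_comm]
  · have h1 := hf.pos t
    have h2 := hg.pos t
    rw [sqrtRatio, max_eq_left ht.le, Real.sqrt_div h1.le, Real.sqrt_mul h1.le, inv_div,
      mul_div_assoc', div_eq_iff (by positivity), mul_right_comm, Real.mul_self_sqrt h1.le]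

theorem integral_sqrtRatio_map_add_lt [IsProbabilityMeasure ν] (hr : IsUnimodalRatio f g x₀)
    (hf : IsContDensity f μ) (hg : IsContDensity g ν) (hα : x₀ ≤ α) {d : ℝ} (hd : 0 < d) :
    ∫ t, sqrtRatio f g α t ∂(ν.map (· + d)) < ∫ t, sqrtRatio f g α t ∂ν := by
  have hc := continuous_sqrtRatio (α := α) hf hg
  have hc' : Continuous fun t => sqrtRatio f g α (t + d) := hc.comp (continuous_add_const d)
  rw [integral_map (measurable_add_const d).aemeasurable hc.aestronglyMeasurable,
    hg.integral_eq, hg.integral_eq, ← sub_pos]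
  have hprod {φ : ℝ → ℝ} (h1 : Continuous φ) (h2 : ∀ t, 0 ≤ φ t) (h3 : ∀ t, φ t ≤ √(f α / g α)) :
      Integrable fun t => g t * φ t :=
    hg.integrable.mul_bdd (c := √(f α / g α)) h1.aestronglyMeasurable
      (Eventually.of_forall fun t => by rw [Real.norm_of_nonneg (h2 t)]; exact h3 t)
  have i1 := hprod hc (fun t => (sqrtRatio_pos hf hg t).le) (sqrtRatio_le hr hα)
  have i2 := hprod hc' (fun t => (sqrtRatio_pos hf hg _).le) (fun t => sqrtRatio_le hr hα _)
  rw [← integral_sub i1 i2]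
  obtain ⟨t, ht⟩ : ∃ t, sqrtRatio f g α (t + d) ≠ sqrtRatio f g α t := by
    by_contra! h
    have h1 (n : ℕ) : sqrtRatio f g α (α + n * d) = sqrtRatio f g α α := by
      induction n with
      | zero => simp
      | succ n ih => rw [← ih, ← h (α + n * d), Nat.cast_succ]; congr 1; ring
    have h2 : Tendsto (fun n : ℕ => α + n * d) atTop atTop :=
      tendsto_atTop_add_const_left _ _ (tendsto_natCast_atTop_atTop.atTop_mul_const hd)
    have h3 : Tendsto (fun n : ℕ => sqrtRatio f g α (α + n * d)) atTop (𝓝 0) := by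
      have := (hr.tendsto.comp h2).sqrt
      rw [Real.sqrt_zero] at this
      refine this.congr fun n => ?_
      rw [sqrtRatio, max_eq_left (by linarith [mul_nonneg n.cast_nonneg hd.le])]
      rfl
    simp only [h1] at h3
    exact (sqrtRatio_pos hf hg α).ne (tendsto_nhds_unique h3 tendsto_const_nhds)
  refine integral_pos_of_integrable_nonneg_nonzero (x := t)
    ((hg.continuous.mul hc).sub (hg.continuous.mul hc')) (i1.sub i2) (fun t => ?_) ?_
  · rw [Pi.zero_apply, ← mul_sub]
    exact mul_nonneg (hg.pos t).le (sub_nonneg.2 (hr.antitone_sqrtRatio hα (by linarith)))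
  · rw [← mul_sub]
    exact mul_ne_zero (hg.pos t).ne' (sub_ne_zero.2 ht.symm)

variable {A B : ℕ → Type*} [∀ n, Fintype (A n)] [∀ n, Fintype (B n)]
  {p : ∀ n, A n → ℝ} {q : ∀ n, B n → ℝ} {c s : ℕ → ℝ}

theorem IsUnimodalRatio.eventually_FD_le {ν' : Measure ℝ} [hμ : IsProbabilityMeasure μ]
    [hν' : IsProbabilityMeasure ν'] (hr : IsUnimodalRatio f g x₀) (hf : IsContDensity f μ)
    (hg : IsContDensity g ν) (hα : f α / g α = μ.real (Iic α) / ν.real (Iic α))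
    (hp : ∀ n, IsProb (p n)) (hq : ∀ n, IsProb (q n))
    (hs : Tendsto s atTop (𝓝 0)) (hs0 : ∀ᶠ n in atTop, 0 < s n)
    (hP : Tendsto (β := ProbabilityMeasure ℝ)
      (fun n => ⟨infoLaw (p n) (c n) (s n), isProbabilityMeasure_infoLaw (hp n) _ _⟩) atTop
      (𝓝 ⟨μ, hμ⟩))
    (hQ : Tendsto (β := ProbabilityMeasure ℝ)
      (fun n => ⟨infoLaw (q n) (c n) (s n), isProbabilityMeasure_infoLaw (hq n) _ _⟩) atTop
      (𝓝 ⟨ν', hν'⟩)) {ε : ℝ} (hε : 0 < ε) :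
    ∀ᶠ n in atTop,
      2 * FD (p n) (q n) ≤ mergedFid f g μ ν α + ∫ t, sqrtRatio f g α t ∂ν' + ε := by
  have hα0 := hr.le_of_eq_div hf hg hα
  have hanti := hr.antitone_sqrtRatio hα0
  have hcont := continuous_sqrtRatio (α := α) hf hg
  have hpos (t) : 0 < sqrtRatio f g α t := sqrtRatio_pos hf hg t
  have hle := sqrtRatio_le hr hα0
  have hκ : 0 < ε / 2 := half_pos hε
  have hmpos (t) : 0 < max (sqrtRatio f g α t) (ε / 2) := hκ.trans_le (le_max_right _ _)
  have hmcont : Continuous fun t => max (sqrtRatio f g α t) (ε / 2) := hcont.max continuous_const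
  have hlcont : Continuous fun t => (max (sqrtRatio f g α t) (ε / 2))⁻¹ :=
    hmcont.inv₀ fun t => (hmpos t).ne'
  have hM (t) : (max (sqrtRatio f g α t) (ε / 2))⁻¹ ≤ (ε / 2)⁻¹ := inv_anti₀ hκ (le_max_right _ _)
  have h1 : ∫ t, (max (sqrtRatio f g α t) (ε / 2))⁻¹ ∂μ ≤ mergedFid f g μ ν α := by
    have h := integrable_and_integral_inv_sqrtRatio hf hg hα
    rw [hf.integral_eq, ← h.2]
    refine integral_mono (hf.integrable.mul_bdd (c := (ε / 2)⁻¹) hlcont.aestronglyMeasurable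
      (Eventually.of_forall fun t => ?_)) h.1 fun t => ?_
    · rw [Real.norm_of_nonneg (inv_pos.2 (hmpos t)).le]
      exact hM t
    · exact mul_le_mul_of_nonneg_left (inv_anti₀ (hpos t) (le_max_left _ _)) (hf.pos t).le
  have hi : Integrable (sqrtRatio f g α) ν' :=
    Integrable.of_bound hcont.aestronglyMeasurable (√(f α / g α))
      (Eventually.of_forall fun t => by rw [Real.norm_of_nonneg (hpos t).le]; exact hle t)
  have h2 : ∫ t, max (sqrtRatio f g α t) (ε / 2) ∂ν' ≤ ∫ t, sqrtRatio f g α t ∂ν' + ε / 2 := by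
    calc ∫ t, max (sqrtRatio f g α t) (ε / 2) ∂ν'
        ≤ ∫ t, (sqrtRatio f g α t + ε / 2) ∂ν' := by
          refine integral_mono (hi.sup (integrable_const _)) (hi.add (integrable_const _))
            fun t => ?_
          exact max_le (by linarith) (by linarith [hpos t])
      _ = _ := by rw [integral_add hi (integrable_const _)]; simp
  have key := RNG.eventually_FD_le hp hq hs hs0 hP hQ
    (lam := fun t => (max (sqrtRatio f g α t) (ε / 2))⁻¹)
    (fun t u htu => inv_anti₀ (hmpos u) (max_le_max (hanti htu) le_rfl)) hlcont
    (m := (max (√(f α / g α)) (ε / 2))⁻¹) (M := (ε / 2)⁻¹)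
    (inv_pos.2 (hκ.trans_le (le_max_right _ _)))
    (fun t => inv_anti₀ (hmpos t) (max_le_max (hle t) le_rfl)) hM hκ
  filter_upwards [key] with n hn
  simp only [inv_inv] at hn
  linarith

end Threshold

section Achievability

open Topology Set

variable {f g : ℝ → ℝ} {μ ν : Measure ℝ} {x₀ x α : ℝ}

theorem IsContDensity.exists_monotone_levels [IsProbabilityMeasure μ] (hf : IsContDensity f μ)
    (α : ℝ) (k : ℕ) (hk : 0 < k) :
    ∃ u : ℕ → ℝ, Monotone u ∧ (∀ i, u i ≤ α) ∧
      ∀ i, μ.real (Iic (u i)) = (min (i + 1) k : ℕ) / k * μ.real (Iic α) := by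
  have hk' : (0 : ℝ) < k := Nat.cast_pos.2 hk
  have hα := hf.real_Iic_pos α
  have (i : ℕ) : ∃ z ≤ α, μ.real (Iic z) = (min (i + 1) k : ℕ) / k * μ.real (Iic α) := by
    refine hf.exists_real_Iic_eq (mul_pos (div_pos (Nat.cast_pos.2 (by omega)) hk') hα) ?_
    refine mul_le_of_le_one_left hα.le ((div_le_one hk').2 (Nat.cast_le.2 (min_le_right _ _)))
  choose u hu1 hu2 using this
  refine ⟨u, fun i j hij => ?_, hu1, hu2⟩
  rw [← hf.strictMono_real_Iic.le_iff_le]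
  simp only [hu2]
  gcongr

theorem IsContDensity.intervalIntegral_sqrt_le (hf : IsContDensity f μ) (hg : IsContDensity g ν)
    {a b h : ℝ} (hab : a < b) :
    ∫ t in a..b, √(f (t + h) * g t) ≤
      √(μ.real (Ico (a + h) (b + h)) * ν.real (Ico a b)) := by
  have h1 := hf.real_Ico_pos (add_lt_add_left hab h)
  have h2 := hg.real_Ico_pos hab
  have e1 : μ.real (Ico (a + h) (b + h)) = ∫ t in a..b, f (t + h) := by
    rw [hf.real_Ico_eq_intervalIntegral (by linarith), intervalIntegral.integral_comp_add_right]
  have e2 := hg.real_Ico_eq_intervalIntegral hab.le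
  set m := μ.real (Ico (a + h) (b + h))
  set n := ν.real (Ico a b)
  have hfc : Continuous fun t => f (t + h) := hf.continuous.comp (continuous_add_const h)
  have hm : 0 < √m := Real.sqrt_pos.2 h1
  have hn : 0 < √n := Real.sqrt_pos.2 h2
  calc ∫ t in a..b, √(f (t + h) * g t)
      ≤ ∫ t in a..b, (√n / √m / 2 * f (t + h) + √m / √n / 2 * g t) := by
        refine intervalIntegral.integral_mono_on hab.le
          ((hfc.mul hg.continuous).sqrt.intervalIntegrable _ _)
          (((hfc.const_mul _).add (hg.continuous.const_mul _)).intervalIntegrable _ _)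
          fun t _ => ?_
        have ht1 := hf.pos (t + h)
        have ht2 := hg.pos t
        have h3 := two_mul_le_add_sq (√(√n / √m * f (t + h))) (√(√m / √n * g t))
        rw [Real.sq_sqrt (by positivity), Real.sq_sqrt (by positivity), mul_assoc,
          ← Real.sqrt_mul (by positivity)] at h3
        have e : √n / √m * f (t + h) * (√m / √n * g t) = f (t + h) * g t := by
          field_simp
        rw [e] at h3
        linarith
    _ = √n / √m / 2 * m + √m / √n / 2 * n := by
        rw [intervalIntegral.integral_add ((hfc.const_mul _).intervalIntegrable _ _)
          ((hg.continuous.const_mul _).intervalIntegrable _ _),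
          intervalIntegral.integral_const_mul, intervalIntegral.integral_const_mul, ← e1, ← e2]
    _ = √(m * n) := by
        have hm2 := Real.mul_self_sqrt h1.le
        have hn2 := Real.mul_self_sqrt h2.le
        rw [Real.sqrt_mul h1.le]
        have e1 : √n / √m / 2 * m = √m * √n / 2 := by
          rw [div_div, div_mul_eq_mul_div, div_eq_div_iff (by positivity) (by norm_num)]
          linear_combination (2 * √n) * (-hm2)
        have e2 : √m / √n / 2 * n = √m * √n / 2 := by
          rw [div_div, div_mul_eq_mul_div, div_eq_div_iff (by positivity) (by norm_num)]
          linear_combination (2 * √m) * (-hn2)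
        rw [e1, e2, add_halves]

theorem exists_lt_sum_of_lt_mergedFid (hf : IsContDensity f μ) (hg : IsContDensity g ν) {r : ℝ}
    (h : r < mergedFid f g μ ν α) :
    ∃ N : ℕ, ∃ h > 0, r < N / (N + 3 : ℕ) * √(μ.real (Iic α) * ν.real (Iic α)) +
      ∫ t in α..α + (N + 1 : ℕ) * h, √(f (t + 2 * h) * g t) := by
  have l1 : Tendsto (fun B => √(μ.real (Iic α) * ν.real (Iic α)) +
      ∫ t in α..B, √(f t * g t)) atTop (𝓝 (mergedFid f g μ ν α)) :=
    (intervalIntegral_tendsto_integral_Ioi α (hf.integrable_sqrt_mul hg).integrableOn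
      tendsto_id).const_add _
  obtain ⟨B, hB, hαB⟩ := ((l1.eventually_const_lt h).and (eventually_gt_atTop α)).exists
  have hB0 := sub_pos.2 hαB
  have l2 : Tendsto (fun h => ∫ t in α..B, √(f (t + 2 * h) * g t)) (𝓝 0)
      (𝓝 (∫ t in α..B, √(f t * g t))) := by
    have hc : Continuous fun h => ∫ t in α..B, √(f (t + 2 * h) * g t) := by
      refine intervalIntegral.continuous_parametric_intervalIntegral_of_continuous' ?_ _ _
      have h1 := hf.continuous
      have h2 := hg.continuous
      simp only [Function.uncurry_def]
      fun_prop
    simpa using hc.tendsto 0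
  have l3 : Tendsto (fun N : ℕ => (B - α) / (N + 1 : ℕ)) atTop (𝓝 0) :=
    (tendsto_const_div_atTop_nhds_zero_nat _).comp (tendsto_add_atTop_nat 1)
  have l4 : Tendsto (fun N : ℕ => (N : ℝ) / (N + 3 : ℕ)) atTop (𝓝 1) := by
    simpa using tendsto_natCast_div_add_atTop (3 : ℝ)
  have l5 := (l4.mul_const √(μ.real (Iic α) * ν.real (Iic α))).add (l2.comp l3)
  rw [one_mul] at l5
  obtain ⟨N, hN⟩ := (l5.eventually_const_lt hB).exists
  refine ⟨N, (B - α) / (N + 1 : ℕ), by positivity, ?_⟩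
  rwa [mul_div_cancel₀ _ (by positivity), add_sub_cancel]

variable {A B : ℕ → Type*} [∀ n, Fintype (A n)] [∀ n, Fintype (B n)]
  {p : ∀ n, A n → ℝ} {q : ∀ n, B n → ℝ} {c s : ℕ → ℝ}

theorem IsUnimodalRatio.eventually_le_FD [hμ : IsProbabilityMeasure μ]
    [hν : IsProbabilityMeasure ν] (hr : IsUnimodalRatio f g x₀) (hf : IsContDensity f μ)
    (hg : IsContDensity g ν) (hα : f α / g α = μ.real (Iic α) / ν.real (Iic α))
    (hp : ∀ n, IsProb (p n)) (hq : ∀ n, IsProb (q n))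
    (hs : Tendsto s atTop (𝓝 0)) (hs0 : ∀ᶠ n in atTop, 0 < s n)
    (hP : Tendsto (β := ProbabilityMeasure ℝ)
      (fun n => ⟨infoLaw (p n) (c n) (s n), isProbabilityMeasure_infoLaw (hp n) _ _⟩) atTop
      (𝓝 ⟨μ, hμ⟩))
    (hQ : Tendsto (β := ProbabilityMeasure ℝ)
      (fun n => ⟨infoLaw (q n) (c n) (s n), isProbabilityMeasure_infoLaw (hq n) _ _⟩) atTop
      (𝓝 ⟨ν, hν⟩)) {r : ℝ} (hlt : r < mergedFid f g μ ν α) :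
    ∀ᶠ n in atTop, r ≤ FD (p n) (q n) := by
  have := hf.nullSingletonClass
  have := hg.nullSingletonClass
  obtain ⟨N, h, hh, hN⟩ := exists_lt_sum_of_lt_mergedFid hf hg hlt
  obtain ⟨u, hu, huα, hGu⟩ := hg.exists_monotone_levels α (N + 3) (by omega)
  obtain ⟨v, hv, hvα, hFv⟩ := hf.exists_monotone_levels α (N + 3) (by omega)
  have hF := hf.real_Iic_pos α
  have hG := hg.real_Iic_pos α
  have hk : (0 : ℝ) < (N + 3 : ℕ) := by positivity
  have huv (i) : u i ≤ v i := by
    rw [← hf.strictMono_real_Iic.le_iff_le]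
    refine (hr.real_Iic_le hf hg hα (huα i)).trans_eq ?_
    simp only [hFv, hGu, hα]
    field_simp
  have hlev {i : ℕ} (hi : i < N + 2) :
      ((min (i + 1 + 1) (N + 3) : ℕ) : ℝ) = (min (i + 1) (N + 3) : ℕ) + 1 := by
    rw [min_eq_left (by omega), min_eq_left (by omega)]
    push_cast
    ring
  have hFd {i : ℕ} (hi : i < N + 2) :
      μ.real (Ico (v i) (v (i + 1))) = μ.real (Iic α) / (N + 3 : ℕ) := by
    rw [hf.real_Ico (hv i.le_succ), hFv, hFv, hlev hi]
    field_simp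
    ring
  have hGd {i : ℕ} (hi : i < N + 2) :
      ν.real (Ico (u i) (u (i + 1))) = ν.real (Iic α) / (N + 3 : ℕ) := by
    rw [hg.real_Ico (hu i.le_succ), hGu, hGu, hlev hi]
    field_simp
    ring
  have hv_lt {i : ℕ} (hi : i < N + 2) : v i < v (i + 1) := by
    by_contra! hle
    have h1 := hFd hi
    rw [Ico_eq_empty hle.not_gt, measureReal_empty] at h1
    exact (div_pos hF hk).ne h1
  set w : ℕ → ℝ := fun j => α + j * h with hw
  have hwm : StrictMono w := fun i j hij => by simp only [hw]; gcongr
  have hαw (j) : α ≤ w j := by simp only [hw]; nlinarith [j.cast_nonneg (α := ℝ)]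
  have hdisj {y : ℕ → ℝ} (hy : Monotone y) {i j : ℕ} (hij : i ≠ j) :
      Disjoint (Ico (y i) (y (i + 1))) (Ico (y j) (y (j + 1))) :=
    hy.pairwise_disjoint_on_Ico_succ hij
  have hdisj' {a b d e : ℝ} (hb : b ≤ α) (hd : α ≤ d) : Disjoint (Ico a b) (Ico d e) :=
    Set.disjoint_left.2 fun _ hx hx' => (hx.2.trans_le (hb.trans (hd.trans hx'.1))).false
  refine RNG.eventually_le_FD (ι := Fin N ⊕ Fin (N + 1)) (r := r) hp hq hs hs0 hP hQ
    (Sum.elim (fun i => v (i + 2)) fun j => w (j + 2))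
    (Sum.elim (fun i => v (i + 2 + 1)) fun j => w (j + 2 + 1))
    (Sum.elim (fun i => u i) fun j => w j)
    (Sum.elim (fun i => u (i + 1)) fun j => w (j + 1)) ?_ ?_ ?_ ?_ ?_
  · rintro (i | j)
    · exact (huv _).trans_lt (hv_lt (by omega))
    · exact hwm (by omega)
  · rintro (i | i) (j | j) hij
    · exact hdisj hv fun e => hij (by congr 1; exact Fin.ext (by omega))
    · exact hdisj' (hvα _) (hαw _)
    · exact (hdisj' (hvα _) (hαw _)).symm
    · exact hdisj hwm.monotone fun e => hij (by congr 1; exact Fin.ext (by omega))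
  · rintro (i | i) (j | j) hij
    · exact hdisj hu fun e => hij (by congr 1; exact Fin.ext (by omega))
    · exact hdisj' (huα _) (hαw _)
    · exact (hdisj' (huα _) (hαw _)).symm
    · exact hdisj hwm.monotone fun e => hij (by congr 1; exact Fin.ext (by omega))
  · rintro (i | j)
    · exact hf.real_Ico_pos (hv_lt (by omega))
    · exact hf.real_Ico_pos (hwm (by omega))
  · rw [Fintype.sum_sum_type]
    refine hN.trans_le (add_le_add (le_of_eq ?_) ?_)
    · simp only [Sum.elim_inl]
      have (i : Fin N) : √(μ.real (Ico (v (i + 2)) (v (i + 2 + 1))) *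
          ν.real (Ico (u i) (u (i + 1)))) =
          √(μ.real (Iic α) * ν.real (Iic α)) / (N + 3 : ℕ) := by
        rw [hFd (by omega), hGd (by omega), div_mul_div_comm, Real.sqrt_div (by positivity),
          Real.sqrt_mul_self hk.le]
      simp only [this, Finset.sum_const, Finset.card_univ, Fintype.card_fin, nsmul_eq_mul]
      ring
    · simp only [Sum.elim_inr]
      have hc : Continuous fun t => √(f (t + 2 * h) * g t) :=
        ((hf.continuous.comp (continuous_add_const _)).mul hg.continuous).sqrt
      have h1 := intervalIntegral.sum_integral_adjacent_intervals (a := w) (n := N + 1)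
        (μ := volume) (f := fun t => √(f (t + 2 * h) * g t))
        fun k _ => hc.intervalIntegrable _ _
      have h2 : w 0 = α := by simp [hw]
      rw [h2] at h1
      rw [← h1, Finset.sum_range]
      refine Finset.sum_le_sum fun j _ => ?_
      refine (hf.intervalIntegral_sqrt_le hg (hwm (Nat.lt_succ_self j))).trans_eq ?_
      have h3 (j : ℕ) : w j + 2 * h = w (j + 2) := by simp only [hw]; push_cast; ring
      rw [h3, h3]

end Achievability

section Rate

open ProbabilityTheory Topology Set

theorem H_pos_of_V_pos [Fintype α] {P : α → ℝ} (hP : IsProb P) (hV : 0 < V P) : 0 < H P := by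
  have hle (x) : P x ≤ 1 := by
    rw [← hP.2]
    exact Finset.single_le_sum (fun y _ => hP.1 y) (Finset.mem_univ x)
  have h0 (x) : 0 ≤ -(P x * Real.log (P x)) :=
    neg_nonneg.2 (mul_nonpos_of_nonneg_of_nonpos (hP.1 x) (Real.log_nonpos (hP.1 x) (hle x)))
  refine (Finset.sum_nonneg fun x _ => h0 x).lt_of_ne fun hH => hV.ne ?_
  have hH : H P = 0 := hH.symm
  have h1 (x) : P x * Real.log (P x) = 0 := by
    have := (Finset.sum_eq_zero_iff_of_nonneg fun x _ => h0 x).1 hH x (Finset.mem_univ x)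
    linarith
  refine (Finset.sum_eq_zero fun x _ => ?_).symm
  rw [hH]
  linear_combination Real.log (P x) * h1 x

theorem normalPDF_eq_gaussianPDFReal (m : ℝ) {v : ℝ} (hv : 0 < v) :
    normalPDF m v = gaussianPDFReal m v.toNNReal := by
  ext t
  rw [normalPDF, gaussianPDFReal, Real.coe_toNNReal v hv.le]

theorem isContDensity_normalPDF (m : ℝ) {v : ℝ} (hv : 0 < v) :
    IsContDensity (normalPDF m v) (gaussianReal m v.toNNReal) :=
  normalPDF_eq_gaussianPDFReal m hv ▸ isContDensity_gaussianReal m (Real.toNNReal_pos.2 hv).ne'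

theorem stdG_mul_sub_eq {m v a : ℝ} (ha : 0 < a) (hav : a ^ 2 * v = 1) (x : ℝ) :
    stdG (a * (x - m)) = (gaussianReal m v.toNNReal).real (Iic x) := by
  have hv : 0 < v := by
    by_contra! h
    nlinarith [sq_nonneg a]
  have hmap : (gaussianReal m v.toNNReal).map (fun t => a * (t - m)) =
      gaussianReal 0 (1 : ℝ).toNNReal := by
    have : (fun t => a * (t - m)) = (fun t => a * t) ∘ fun t => t + -m := by
      ext t; simp [sub_eq_add_neg]
    rw [this, ← Measure.map_map (by fun_prop) (by fun_prop), gaussianReal_map_add_const,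
      gaussianReal_map_const_mul]
    congr 1
    · ring
    · ext
      simp [hv.le, hav]
  have hpre : (fun t => a * (t - m)) ⁻¹' Iic (a * (x - m)) = Iic x := by
    ext t
    simp [mul_le_mul_iff_right₀ ha]
  rw [stdG, ← (isContDensity_normalPDF 0 one_pos).real_apply measurableSet_Iic, ← hmap,
    map_measureReal_apply (by fun_prop) measurableSet_Iic, hpre]

theorem tendsto_floor_sub_div_sqrt {r : ℝ} (hr : 0 < r) (b : ℝ) :
    Tendsto (fun n : ℕ => ((⌊r * n + b * √n⌋₊ : ℝ) - r * n) / √n) atTop (𝓝 b) := by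
  have hsq : Tendsto (fun n : ℕ => √(n : ℝ)) atTop atTop :=
    Real.tendsto_sqrt_atTop.comp tendsto_natCast_atTop_atTop
  have h1 : Tendsto (fun n : ℕ => b - (√(n : ℝ))⁻¹) atTop (𝓝 b) := by
    simpa using (tendsto_inv_atTop_zero.comp hsq).const_sub b
  refine tendsto_of_tendsto_of_tendsto_of_le_of_le' h1 tendsto_const_nhds ?_ ?_
  · filter_upwards [hsq.eventually_gt_atTop 0] with n hn
    rw [le_div_iff₀ hn, sub_mul, inv_mul_cancel₀ hn.ne']
    linarith [Nat.lt_floor_add_one (r * n + b * √n)]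
  · filter_upwards [hsq.eventually_gt_atTop 0, hsq.eventually_ge_atTop (-b / r)] with n hn hn2
    rw [div_le_iff₀ hn]
    have h2 : 0 ≤ r * n + b * √n := by
      have h3 := Real.mul_self_sqrt (n.cast_nonneg (α := ℝ))
      rw [div_le_iff₀ hr] at hn2
      nlinarith
    linarith [Nat.floor_le h2]

variable {X Y : Type*} [Fintype X] [Fintype Y] {P : X → ℝ} {Q : Y → ℝ}

theorem tendsto_infoLaw_iid_source (hP : IsProb P) (hVP : 0 < V P) :
    Tendsto (β := ProbabilityMeasure ℝ) (fun n : ℕ => ⟨infoLaw (iid P n) (n * H P) (√n)⁻¹,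
      isProbabilityMeasure_infoLaw (isProb_iid hP n) _ _⟩) atTop
      (𝓝 ⟨gaussianReal 0 (V P).toNNReal, inferInstance⟩) := by
  have hsq : Tendsto (fun n : ℕ => √(n : ℝ)) atTop atTop :=
    Real.tendsto_sqrt_atTop.comp tendsto_natCast_atTop_atTop
  have key := tendsto_infoLaw_iid hP hVP (L := id) (c := fun n => n * H P)
    (s := fun n => (√n)⁻¹) (κ := 1) (m := 0) zero_le_one (tendsto_inv_atTop_zero.comp hsq) ?_ ?_
  · simpa only [one_mul, id] using key
  · refine tendsto_const_nhds.congr' ?_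
    filter_upwards [eventually_gt_atTop 0] with n hn
    have : (0 : ℝ) < n := Nat.cast_pos.2 hn
    rw [inv_pow, Real.sq_sqrt this.le, id, mul_inv_cancel₀ this.ne']
  · simp

theorem tendsto_infoLaw_iid_target (hQ : IsProb Q) (hVQ : 0 < V Q) (hHP : 0 < H P)
    {L : ℕ → ℕ} {b : ℝ}
    (hL : Tendsto (fun n : ℕ => ((L n : ℝ) - H P / H Q * n) / √n) atTop (𝓝 b)) :
    Tendsto (β := ProbabilityMeasure ℝ) (fun n : ℕ => ⟨infoLaw (iid Q (L n)) (n * H P) (√n)⁻¹,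
      isProbabilityMeasure_infoLaw (isProb_iid hQ (L n)) _ _⟩) atTop
      (𝓝 ⟨gaussianReal (H Q * b) (H P / H Q * V Q).toNNReal, inferInstance⟩) := by
  have hHQ := H_pos_of_V_pos hQ hVQ
  have hs : Tendsto (fun n : ℕ => (√(n : ℝ))⁻¹) atTop (𝓝 0) := tendsto_inv_atTop_zero.comp
    (Real.tendsto_sqrt_atTop.comp tendsto_natCast_atTop_atTop)
  refine tendsto_infoLaw_iid hQ hVQ (div_pos hHP hHQ).le hs ?_ ?_
  · have h1 := (hL.mul hs).const_add (H P / H Q)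
    rw [mul_zero, add_zero] at h1
    refine h1.congr' ?_
    filter_upwards [eventually_gt_atTop 0] with n hn
    have hn : (0 : ℝ) < n := Nat.cast_pos.2 hn
    rw [← div_eq_mul_inv, div_div, Real.mul_self_sqrt hn.le, inv_pow, Real.sq_sqrt hn.le]
    field_simp
    ring
  · refine (hL.const_mul (H Q)).congr fun n => ?_
    rw [div_eq_mul_inv]
    field_simp

theorem isContDensity_NP (hVP : 0 < V P) :
    IsContDensity (NP P) (gaussianReal 0 (V P).toNNReal) :=
  isContDensity_normalPDF 0 hVP

theorem isContDensity_NPQ (hHP : 0 < H P) (hHQ : 0 < H Q) (hVQ : 0 < V Q) (b : ℝ) :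
    IsContDensity (NPQ P Q b) (gaussianReal (H Q * b) (H P / H Q * V Q).toNNReal) :=
  isContDensity_normalPDF _ (by positivity)

theorem GP_eq (hVP : 0 < V P) (x : ℝ) :
    GP P x = (gaussianReal 0 (V P).toNNReal).real (Iic x) := by
  rw [← stdG_mul_sub_eq (a := (√(V P))⁻¹) (by positivity)
    (by rw [inv_pow, Real.sq_sqrt hVP.le, inv_mul_cancel₀ hVP.ne']), GP, sub_zero, div_eq_inv_mul]

theorem GPQ_eq (hHP : 0 < H P) (hHQ : 0 < H Q) (hVQ : 0 < V Q) (b x : ℝ) :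
    GPQ P Q b x = (gaussianReal (H Q * b) (H P / H Q * V Q).toNNReal).real (Iic x) := by
  rw [← stdG_mul_sub_eq (a := √(H Q / (H P * V Q))) (by positivity)
    (by rw [Real.sq_sqrt (by positivity)]; field_simp), GPQ]

theorem exists_isUnimodalRatio_NP_NPQ (hHQ : 0 < H Q) (hVP : 0 < V P)
    (hVQ : 0 < V Q) (hratio : H Q / V Q < H P / V P) (b : ℝ) :
    ∃ x₀, IsUnimodalRatio (NP P) (NPQ P Q b) x₀ := by
  have hv : V P < H P / H Q * V Q := by
    rw [div_lt_div_iff₀ hVQ hVP] at hratio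
    rw [div_mul_eq_mul_div, lt_div_iff₀ hHQ]
    linarith
  have h1 : NP P = _ := normalPDF_eq_gaussianPDFReal 0 hVP
  have h2 : NPQ P Q b = _ := normalPDF_eq_gaussianPDFReal (H Q * b) (hVP.trans hv)
  rw [h1, h2]
  exact exists_isUnimodalRatio_gaussianPDFReal _ _ (Real.toNNReal_pos.2 hVP)
    ((Real.toNNReal_lt_toNNReal_iff (hVP.trans hv)).2 hv)

theorem mergedFid_eq (hHP : 0 < H P) (hHQ : 0 < H Q) (hVP : 0 < V P) (hVQ : 0 < V Q) (b α : ℝ) :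
    mergedFid (NP P) (NPQ P Q b) (gaussianReal 0 (V P).toNNReal)
        (gaussianReal (H Q * b) (H P / H Q * V Q).toNNReal) α =
      √(GP P α * GPQ P Q b α) + IPQinf P Q b - IPQ P Q b α := by
  have hi := (isContDensity_NP hVP).integrable_sqrt_mul (isContDensity_NPQ hHP hHQ hVQ b)
  rw [mergedFid, GP_eq hVP, GPQ_eq hHP hHQ hVQ, IPQ, IPQinf,
    ← intervalIntegral.integral_Iic_add_Ioi (b := α) hi.integrableOn hi.integrableOn]
  ring

theorem tendsto_FD_iid (hP : IsProb P) (hQ : IsProb Q) (hVP : 0 < V P) (hVQ : 0 < V Q)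
    (hratio : H Q / V Q < H P / V P) {b α : ℝ}
    (hα : NP P α / NPQ P Q b α = GP P α / GPQ P Q b α) {L : ℕ → ℕ}
    (hL : Tendsto (fun n : ℕ => ((L n : ℝ) - H P / H Q * n) / √n) atTop (𝓝 b)) :
    Tendsto (fun n => FD (iid P n) (iid Q (L n))) atTop
      (𝓝 (√(GP P α * GPQ P Q b α) + IPQinf P Q b - IPQ P Q b α)) := by
  have hHP := H_pos_of_V_pos hP hVP
  have hHQ := H_pos_of_V_pos hQ hVQ
  have hf := isContDensity_NP hVP
  have hg := isContDensity_NPQ hHP hHQ hVQ b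
  obtain ⟨x₀, hr⟩ := exists_isUnimodalRatio_NP_NPQ hHQ hVP hVQ hratio b
  have hsq : Tendsto (fun n : ℕ => √(n : ℝ)) atTop atTop :=
    Real.tendsto_sqrt_atTop.comp tendsto_natCast_atTop_atTop
  have hs : Tendsto (fun n : ℕ => (√(n : ℝ))⁻¹) atTop (𝓝 0) := tendsto_inv_atTop_zero.comp hsq
  have hs0 : ∀ᶠ n : ℕ in atTop, 0 < (√(n : ℝ))⁻¹ :=
    (hsq.eventually_gt_atTop 0).mono fun n hn => inv_pos.2 hn
  have h1 := tendsto_infoLaw_iid_source hP hVP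
  have h2 := tendsto_infoLaw_iid_target hQ hVQ hHP hL
  rw [GP_eq hVP, GPQ_eq hHP hHQ hVQ] at hα
  rw [← mergedFid_eq hHP hHQ hVP hVQ]
  refine tendsto_order.2 ⟨fun a ha => ?_, fun a ha => ?_⟩
  · obtain ⟨a', ha', ha''⟩ := exists_between ha
    filter_upwards [hr.eventually_le_FD hf hg hα (isProb_iid hP) (fun n => isProb_iid hQ (L n))
      hs hs0 h1 h2 ha''] with n hn
    linarith
  · filter_upwards [hr.eventually_FD_le hf hg hα (isProb_iid hP) (fun n => isProb_iid hQ (L n))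
      hs hs0 h1 h2 (sub_pos.2 ha)] with n hn
    rw [integral_sqrtRatio hf hg hα] at hn
    linarith

theorem exists_eventually_FD_iid_le (hP : IsProb P) (hQ : IsProb Q) (hVP : 0 < V P)
    (hVQ : 0 < V Q) (hratio : H Q / V Q < H P / V P) {b b' α : ℝ} (hbb' : b < b')
    (hα : NP P α / NPQ P Q b α = GP P α / GPQ P Q b α) {L : ℕ → ℕ}
    (hL : Tendsto (fun n : ℕ => ((L n : ℝ) - H P / H Q * n) / √n) atTop (𝓝 b')) :
    ∃ r < √(GP P α * GPQ P Q b α) + IPQinf P Q b - IPQ P Q b α,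
      ∀ᶠ n in atTop, FD (iid P n) (iid Q (L n)) ≤ r := by
  have hHP := H_pos_of_V_pos hP hVP
  have hHQ := H_pos_of_V_pos hQ hVQ
  have hf := isContDensity_NP hVP
  have hg := isContDensity_NPQ hHP hHQ hVQ b
  obtain ⟨x₀, hr⟩ := exists_isUnimodalRatio_NP_NPQ hHQ hVP hVQ hratio b
  have hsq : Tendsto (fun n : ℕ => √(n : ℝ)) atTop atTop :=
    Real.tendsto_sqrt_atTop.comp tendsto_natCast_atTop_atTop
  have hs : Tendsto (fun n : ℕ => (√(n : ℝ))⁻¹) atTop (𝓝 0) := tendsto_inv_atTop_zero.comp hsq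
  have hs0 : ∀ᶠ n : ℕ in atTop, 0 < (√(n : ℝ))⁻¹ :=
    (hsq.eventually_gt_atTop 0).mono fun n hn => inv_pos.2 hn
  have h1 := tendsto_infoLaw_iid_source hP hVP
  have h2 := tendsto_infoLaw_iid_target hQ hVQ hHP hL
  rw [GP_eq hVP, GPQ_eq hHP hHQ hVQ] at hα
  rw [← mergedFid_eq hHP hHQ hVP hVQ]
  have hlt := integral_sqrtRatio_map_add_lt hr hf hg (hr.le_of_eq_div hf hg hα)
    (mul_pos hHQ (sub_pos.2 hbb'))
  rw [gaussianReal_map_add_const, integral_sqrtRatio hf hg hα, ← mul_add, add_sub_cancel] at hlt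
  obtain ⟨r, hr1, hr2⟩ := exists_between hlt
  refine ⟨_, add_div_two_lt_right.2 hr2, ?_⟩
  filter_upwards [hr.eventually_FD_le hf hg hα (isProb_iid hP) (fun n => isProb_iid hQ (L n))
    hs hs0 h1 h2 (sub_pos.2 hr1)] with n hn
  linarith

theorem LD_le (hP : IsProb P) (hQ : IsProb Q) {ν : ℝ} {n K : ℕ}
    (h : FD (iid P n) (iid Q K) < ν) : LD P Q ν n ≤ K :=
  csSup_le' fun _ hL => le_of_not_ge fun hK =>
    (hL.trans (FD_iid_antitone (isProb_iid hP n) hQ hK)).not_gt h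

theorem le_LD (hP : IsProb P) (hQ : IsProb Q) {ν : ℝ} {n K K' : ℕ}
    (h : FD (iid P n) (iid Q K) < ν) (h' : ν ≤ FD (iid P n) (iid Q K')) : K' ≤ LD P Q ν n :=
  le_csSup ⟨K, fun _ hL => le_of_not_ge fun hK =>
    (hL.trans (FD_iid_antitone (isProb_iid hP n) hQ hK)).not_gt h⟩ h'

end Rate

/-- second order expansion of `L^D_n(P,Q|ν)` when
`H(P)/V(P) > H(Q)/V(Q)`; here `α` is the threshold for `b` and `F_1(b) = ν`. -/
theorem second_order_rate_case_gt {X Y : Type*} [Fintype X] [Fintype Y]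
    (P : X → ℝ) (Q : Y → ℝ) (hP : IsProb P) (hQ : IsProb Q)
    (hVP : 0 < V P) (hVQ : 0 < V Q)
    (hratio : H Q / V Q < H P / V P)
    (ν : ℝ) (hν : 0 < ν ∧ ν < 1) (b α : ℝ)
    (hα : NP P α / NPQ P Q b α = GP P α / GPQ P Q b α)
    (hb : Real.sqrt (GP P α * GPQ P Q b α) + IPQinf P Q b - IPQ P Q b α = ν) :
    Tendsto (fun n : ℕ =>
        ((LD P Q ν n : ℝ) - H P / H Q * n) / Real.sqrt n) atTop (nhds b) ∧
    RD2 P Q ν = b := by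
  have hHP := H_pos_of_V_pos hP hVP
  have hHQ := H_pos_of_V_pos hQ hVQ
  have hK (b' : ℝ) := tendsto_floor_sub_div_sqrt (div_pos hHP hHQ) b'
  have hFD := tendsto_FD_iid hP hQ hVP hVQ hratio hα (hK b)
  have hupper {b' : ℝ} (hbb' : b < b') : ∃ r < ν, ∀ᶠ n : ℕ in atTop,
      FD (iid P n) (iid Q ⌊H P / H Q * n + b' * √n⌋₊) ≤ r :=
    hb ▸ exists_eventually_FD_iid_le hP hQ hVP hVQ hratio hbb' hα (hK b')
  have hlower {b' : ℝ} (hb'b : b' < b) : ∀ᶠ n : ℕ in atTop,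
      ν ≤ FD (iid P n) (iid Q ⌊H P / H Q * n + b' * √n⌋₊) := by
    have hg := isContDensity_NPQ hHP hHQ hVQ b'
    obtain ⟨x₀, hr⟩ := exists_isUnimodalRatio_NP_NPQ hHQ hVP hVQ hratio b'
    obtain ⟨α', hα'⟩ := hr.exists_eq_div (isContDensity_NP hVP) hg
    rw [← GP_eq hVP, ← GPQ_eq hHP hHQ hVQ] at hα'
    obtain ⟨r, hr1, hr2⟩ :=
      exists_eventually_FD_iid_le hP hQ hVP hVQ hratio hb'b hα' (hK b)
    have hνr : ν ≤ r := hb ▸ le_of_tendsto hFD hr2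
    exact ((tendsto_FD_iid hP hQ hVP hVQ hratio hα' (hK b')).eventually_const_lt
      (hνr.trans_lt hr1)).mono fun n hn => hn.le
  have hlt {b' : ℝ} (hbb' : b < b') : ∀ᶠ n : ℕ in atTop,
      FD (iid P n) (iid Q ⌊H P / H Q * n + b' * √n⌋₊) < ν := by
    obtain ⟨r, hr, h⟩ := hupper hbb'
    exact h.mono fun n hn => hn.trans_lt hr
  refine ⟨tendsto_order.2 ⟨fun a ha => ?_, fun a ha => ?_⟩, IsGreatest.csSup_eq ⟨?_, ?_⟩⟩
  · obtain ⟨b', hab', hb'b⟩ := exists_between ha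
    filter_upwards [hlower hb'b, hlt (lt_add_one b), (hK b').eventually_const_lt hab']
      with n h1 h2 h3
    refine h3.trans_le ?_
    gcongr
    exact le_LD hP hQ h2 h1
  · obtain ⟨b', hbb', hb'a⟩ := exists_between ha
    filter_upwards [hlt hbb', (hK b').eventually_lt_const hb'a] with n h1 h2
    refine h2.trans_le' ?_
    gcongr
    exact LD_le hP hQ h1
  · exact ⟨ν, le_rfl, hb ▸ hFD⟩
  · rintro b' ⟨c, hc, h⟩
    by_contra! hbb'
    obtain ⟨r, hr, hle⟩ := hupper hbb'
    exact (hc.trans (le_of_tendsto h hle)).not_gt hr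

end RNG
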